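/- (Γ-convergence of the time-discretized optimal transportation meshfree scheme, Theorem 5.1.) Suppose that V is bounded or that b − a ≤ √(m/(32c₂)). Let h_N > 0 with h_N → 0 as N → ∞, and for each N fix a partition a = τ₀^N < τ₁^N < … < τ_{l_N}^N = b with max_j (τ_j^N − τ_{j−1}^N) ≤ h_N, with associated discrete action 𝒜^{[h_N]} and functional 𝔸^{[h_N]}_{μ_a^{(N)},μ_b^{(N)}}. Then 𝔸^{[h_N]}_{μ_a^{(N)},μ_b^{(N)}} Γ-converges to 𝔸_{μ_a,μ_b} on 𝒫(C([a,b];ℝⁿ)) with respect to weak convergence: (i) whenever π^{(N)} ⇀ π weakly, liminf_{N→∞} 𝔸^{[h_N]}_{μ_a^{(N)},μ_b^{(N)}}(π^{(N)}) ≥ 𝔸_{μ_a,μ_b}(π); and (ii) for every π ∈ 𝒫(C([a,b];ℝⁿ)) there exists a sequence π^{(N)} ⇀ π with lim_{N→∞} 𝔸^{[h_N]}_{μ_a^{(N)},μ_b^{(N)}}(π^{(N)}) = 𝔸_{μ_a,μ_b}(π). -/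

import Mathlib

open MeasureTheory Filter Topology
open scoped ENNReal NNReal

noncomputable section

/-- Euclidean space `ℝⁿ`. -/
abbrev Eu (n : ℕ) := EuclideanSpace ℝ (Fin n)

/-- The space `C([a,b];ℝⁿ)` of continuous curves with the supremum metric. -/
abbrev CPath (a b : ℝ) (n : ℕ) := C(Set.Icc a b, Eu n)

/-- We endow the path space with its Borel σ-algebra. -/
noncomputable instance pathMeasurableSpace (a b : ℝ) (n : ℕ) :
    MeasurableSpace (CPath a b n) := borel _

instance pathBorelSpace (a b : ℝ) (n : ℕ) : BorelSpace (CPath a b n) :=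
  ⟨rfl⟩

/-- Evaluation of a curve at time `t ∈ [a,b]` (junk value `0` outside `[a,b]`). -/
def pev {a b : ℝ} {n : ℕ} (γ : CPath a b n) (t : ℝ) : Eu n :=
  if ht : t ∈ Set.Icc a b then γ ⟨t, ht⟩ else 0

/-- A curve is absolutely continuous if it has a Bochner-integrable derivative `g` with
`γ t = γ s + ∫_s^t g`. -/
def IsACC {a b : ℝ} {n : ℕ} (γ : CPath a b n) : Prop :=
  ∃ g : ℝ → Eu n, IntegrableOn g (Set.Icc a b) ∧
    ∀ s t : Set.Icc a b, γ t = γ s + ∫ u in (s : ℝ)..(t : ℝ), g u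

open Classical in
/-- The action `𝒜(γ) = ∫_a^b L(γ(t), γ̇(t)) dt ∈ (−∞,+∞]`, equal to `+∞` on curves that are
not absolutely continuous (and, by the convention that the integral is `+∞` when the
integrand fails to be integrable -- its negative part being automatically integrable --
also on absolutely continuous curves with non-integrable Lagrangian). -/
def action {n : ℕ} (L : Eu n → Eu n → ℝ) (a b : ℝ) (γ : CPath a b n) : EReal :=
  if h : IsACC γ then
    (if IntegrableOn (fun t => L (pev γ t) (h.choose t)) (Set.Icc a b) then
      (((∫ t in Set.Icc a b, L (pev γ t) (h.choose t)) : ℝ) : EReal)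
    else ⊤)
  else ⊤

/-- Positive part of an extended real, as `ℝ≥0∞`. -/
def epos (x : EReal) : ℝ≥0∞ := if x = ⊤ then ⊤ else ENNReal.ofReal x.toReal

/-- The integral `∫ F dπ ∈ [−∞,+∞]` of an extended-real-valued function, defined as the
difference of the lower integrals of the positive and negative parts. -/
def mint {X : Type*} [MeasurableSpace X] (F : X → EReal) (π : Measure X) : EReal :=
  ((∫⁻ γ, epos (F γ) ∂π : ℝ≥0∞) : EReal) - ((∫⁻ γ, epos (-(F γ)) ∂π : ℝ≥0∞) : EReal)

open Classical in
/-- The constrained functional `𝔸_{μa,μb}(π) = ∫ 𝒜 dπ` if `pr_a#π = μa` and `pr_b#π = μb`,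
and `+∞` otherwise, for a given (extended-real-valued) action functional `F`. -/
def aFun {a b : ℝ} {n : ℕ} (F : CPath a b n → EReal) (μa μb : Measure (Eu n))
    (π : Measure (CPath a b n)) : EReal :=
  if Measure.map (fun γ => pev γ a) π = μa ∧ Measure.map (fun γ => pev γ b) π = μb then
    mint F π
  else ⊤

/-- Weak convergence of a sequence of measures: convergence of the integrals of all bounded
continuous functions. -/
def WeakLim {X : Type*} [TopologicalSpace X] [MeasurableSpace X]
    (πs : ℕ → Measure X) (π : Measure X) : Prop :=
  ∀ φ : BoundedContinuousFunction X ℝ,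
    Tendsto (fun N => ∫ x, φ x ∂(πs N)) atTop (𝓝 (∫ x, φ x ∂π))

/-- The empirical measure `(1/N) ∑_{i=1}^N δ_{x i}`. -/
def emp {X : Type*} [MeasurableSpace X] (N : ℕ) (x : Fin N → X) : Measure X :=
  (N : ℝ≥0∞)⁻¹ • ∑ i : Fin N, Measure.dirac (x i)

/-- The topological support of a measure. -/
def msupp {α : Type*} [TopologicalSpace α] [MeasurableSpace α] (μ : Measure α) : Set α :=
  {x | ∀ U : Set α, IsOpen U → x ∈ U → 0 < μ U}

/-- The set `Γ^min_{K₁,K₂}` of minimizing extremals starting in `K₁` and ending in `K₂`. -/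
def GammaMin {n : ℕ} (L : Eu n → Eu n → ℝ) (a b : ℝ) (K₁ K₂ : Set (Eu n)) :
    Set (CPath a b n) :=
  {γ | IsACC γ ∧ pev γ a ∈ K₁ ∧ pev γ b ∈ K₂ ∧
    ∀ γ' : CPath a b n, IsACC γ' → pev γ' a = pev γ a → pev γ' b = pev γ b →
      action L a b γ ≤ action L a b γ'}

/-- The Lagrangian cost `c(x,y)`: the minimal action among absolutely continuous curves
from `x` to `y`. -/
def cost {n : ℕ} (L : Eu n → Eu n → ℝ) (a b : ℝ) (x y : Eu n) : EReal :=
  ⨅ γ ∈ {γ : CPath a b n | IsACC γ ∧ pev γ a = x ∧ pev γ b = y}, action L a b γ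

/-- The restriction of a continuous curve `ℝ → ℝⁿ` to `[a,b]` as an element of the path
space. -/
def toPath {n : ℕ} (a b : ℝ) (f : ℝ → Eu n) (hf : Continuous f) : CPath a b n :=
  (ContinuousMap.mk f hf).restrict (Set.Icc a b)

/-- `Φ : ℝⁿ × ℝⁿ → C([a,b];ℝⁿ)` is the Euler–Lagrange (Newton) flow map for the Lagrangian
`L(x,v) = (m/2)|v|² − V(x)`: it is continuous and `Φ(x,v)` is a `C²` solution of
`m γ'' = −∇V(γ)` with initial position `x` and initial velocity `v`. -/
def IsNewtonFlow {n : ℕ} (m : ℝ) (V : Eu n → ℝ) (a b : ℝ)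
    (Φ : Eu n × Eu n → CPath a b n) : Prop :=
  Continuous Φ ∧ ∀ x v : Eu n, ∃ f : ℝ → Eu n, ContDiff ℝ 2 f ∧
    (∀ t : Set.Icc a b, Φ (x, v) t = f t) ∧ f a = x ∧ deriv f a = v ∧
    ∀ t ∈ Set.Icc a b, m • deriv (deriv f) t = -gradient V (f t)

/-- The set of `C²` solutions of `m γ'' = −∇V(γ)` starting in `Ka` and ending in `Kb`,
viewed as a subset of the path space. -/
def NewtonSet {n : ℕ} (m : ℝ) (V : Eu n → ℝ) (a b : ℝ) (Ka Kb : Set (Eu n)) :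
    Set (CPath a b n) :=
  {γ | ∃ f : ℝ → Eu n, ContDiff ℝ 2 f ∧ (∀ t : Set.Icc a b, γ t = f t) ∧
    (∀ t ∈ Set.Icc a b, m • deriv (deriv f) t = -gradient V (f t)) ∧
    f a ∈ Ka ∧ f b ∈ Kb}

/-- `γ` is piecewise affine subordinate to the partition `a = τ₀ < … < τ_l = b`. -/
def PiecewiseAffine {n : ℕ} (a b : ℝ) (τ : ℕ → ℝ) (l : ℕ) (γ : CPath a b n) : Prop :=
  ∀ j < l, ∀ t : Set.Icc a b, (t : ℝ) ∈ Set.Icc (τ j) (τ (j + 1)) →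
    γ t = pev γ (τ j) + (((t : ℝ) - τ j) / (τ (j + 1) - τ j)) •
      (pev γ (τ (j + 1)) - pev γ (τ j))

/-- `IsPartition a b τ l h`: `a = τ₀ < τ₁ < … < τ_l = b` is a partition of `[a,b]` of mesh
at most `h`. -/
def IsPartition (a b : ℝ) (τ : ℕ → ℝ) (l : ℕ) (h : ℝ) : Prop :=
  1 ≤ l ∧ τ 0 = a ∧ τ l = b ∧ (∀ j < l, τ j < τ (j + 1)) ∧
    ∀ j < l, τ (j + 1) - τ j ≤ h

/-- The midpoint-rule discrete action, as a (real-valued) sum over the first `l` intervals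
of the partition. -/
def dActionSum {n : ℕ} (m : ℝ) (V : Eu n → ℝ) {a b : ℝ} (τ : ℕ → ℝ) (l : ℕ)
    (γ : CPath a b n) : ℝ :=
  ∑ j ∈ Finset.range l,
    (m / 2 * ‖pev γ (τ (j + 1)) - pev γ (τ j)‖ ^ 2 / (τ (j + 1) - τ j) -
      V ((2 : ℝ)⁻¹ • (pev γ (τ (j + 1)) + pev γ (τ j))) * (τ (j + 1) - τ j))

open Classical in
/-- The discrete action `𝒜^{[h]}`: the midpoint-rule discrete action for piecewise affine
curves subordinate to the partition, `+∞` otherwise. -/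
def dAction {n : ℕ} (m : ℝ) (V : Eu n → ℝ) (a b : ℝ) (τ : ℕ → ℝ) (l : ℕ)
    (γ : CPath a b n) : EReal :=
  if PiecewiseAffine a b τ l γ then ((dActionSum m V τ l γ : ℝ) : EReal) else ⊤

/-- The discrete Euler–Lagrange equations for a piecewise affine curve subordinate to the
partition `a = τ₀ < … < τ_l = b`. -/
def DiscreteEL {n : ℕ} (m : ℝ) (V : Eu n → ℝ) {a b : ℝ} (τ : ℕ → ℝ) (l : ℕ)
    (γ : CPath a b n) : Prop :=
  ∀ j, 1 ≤ j → j < l →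
    m • ((τ j - τ (j - 1))⁻¹ • (pev γ (τ j) - pev γ (τ (j - 1)))) -
      m • ((τ (j + 1) - τ j)⁻¹ • (pev γ (τ (j + 1)) - pev γ (τ j))) =
    ((τ j - τ (j - 1)) / 2) • gradient V ((2 : ℝ)⁻¹ • (pev γ (τ (j - 1)) + pev γ (τ j))) +
      ((τ (j + 1) - τ j) / 2) • gradient V ((2 : ℝ)⁻¹ • (pev γ (τ j) + pev γ (τ (j + 1))))

end

section PathEnergy

variable {a b : ℝ} {n : ℕ}

/-- `g` is a square-integrable derivative of the curve `γ`. -/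
noncomputable def IsL2Deriv (γ : CPath a b n) (g : ℝ → Eu n) : Prop :=
  MemLp g 2 (volume.restrict (Set.Icc a b)) ∧
    ∀ s t : Set.Icc a b, γ t = γ s + ∫ u in (s : ℝ)..(t : ℝ), g u

/-- The discrete kinetic energy `∑ ‖Δγ‖² / Δτ` along a partition. -/
noncomputable def discreteKinetic (τ : ℕ → ℝ) (l : ℕ) (γ : CPath a b n) : ℝ :=
  ∑ j ∈ Finset.range l, ‖pev γ (τ (j + 1)) - pev γ (τ j)‖ ^ 2 / (τ (j + 1) - τ j)

/-- The midpoint-rule approximation of `∫ V(γ)`. -/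
noncomputable def discretePotential (V : Eu n → ℝ) (τ : ℕ → ℝ) (l : ℕ) (γ : CPath a b n) : ℝ :=
  ∑ j ∈ Finset.range l,
    V ((2 : ℝ)⁻¹ • (pev γ (τ (j + 1)) + pev γ (τ j))) * (τ (j + 1) - τ j)

/-- The integral of `V` along a curve. -/
noncomputable def potential (V : Eu n → ℝ) (γ : CPath a b n) : ℝ :=
  ∫ t in Set.Icc a b, V (pev γ t)

lemma dActionSum_eq (m : ℝ) (V : Eu n → ℝ) (τ : ℕ → ℝ) (l : ℕ) (γ : CPath a b n) :
    dActionSum m V τ l γ = m / 2 * discreteKinetic τ l γ - discretePotential V τ l γ := by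
  simp only [dActionSum, discreteKinetic, discretePotential, Finset.mul_sum,
    Finset.sum_sub_distrib, mul_div_assoc]

lemma pev_of_mem (γ : CPath a b n) {t : ℝ} (ht : t ∈ Set.Icc a b) : pev γ t = γ ⟨t, ht⟩ := by
  simp [pev, ht]

lemma continuousOn_pev (γ : CPath a b n) : ContinuousOn (pev γ) (Set.Icc a b) := by
  rw [continuousOn_iff_continuous_domRestrict]
  convert γ.continuous using 1
  ext1 t
  simp [pev]

lemma norm_pev_le (γ : CPath a b n) (t : ℝ) : ‖pev γ t‖ ≤ ‖γ‖ := by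
  unfold pev
  split_ifs with ht
  · exact γ.norm_coe_le_norm _
  · simp

lemma continuous_pev_left (t : ℝ) : Continuous fun γ : CPath a b n => pev γ t := by
  unfold pev
  split_ifs with ht
  · exact continuous_eval_const _
  · exact continuous_const

lemma dist_pev_le (γ γ' : CPath a b n) (t : ℝ) : dist (pev γ t) (pev γ' t) ≤ dist γ γ' := by
  unfold pev
  split_ifs with ht
  · exact ContinuousMap.dist_apply_le_dist _
  · simp

lemma discreteKinetic_nonneg {τ : ℕ → ℝ} {l : ℕ} {h : ℝ} (hp : IsPartition a b τ l h)
    (γ : CPath a b n) : 0 ≤ discreteKinetic τ l γ :=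
  Finset.sum_nonneg fun j hj =>
    div_nonneg (by positivity) (sub_nonneg.2 (hp.2.2.2.1 j (Finset.mem_range.1 hj)).le)

lemma IsPartition.monotoneOn {τ : ℕ → ℝ} {l : ℕ} {h : ℝ} (hp : IsPartition a b τ l h)
    {i j : ℕ} (hij : i ≤ j) (hj : j ≤ l) : τ i ≤ τ j := by
  induction j, hij using Nat.le_induction with
  | base => exact le_rfl
  | succ k hk ih => exact (ih (by omega)).trans (hp.2.2.2.1 k (by omega)).le

lemma IsPartition.mem_Icc {τ : ℕ → ℝ} {l : ℕ} {h : ℝ} (hp : IsPartition a b τ l h)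
    {j : ℕ} (hj : j ≤ l) : τ j ∈ Set.Icc a b := by
  have h1 := hp.monotoneOn (Nat.zero_le j) hj
  have h2 := hp.monotoneOn hj le_rfl
  rw [hp.2.1] at h1
  rw [hp.2.2.1] at h2
  exact ⟨h1, h2⟩

lemma IsPartition.sum_sub {τ : ℕ → ℝ} {l : ℕ} {h : ℝ} (hp : IsPartition a b τ l h) :
    ∑ j ∈ Finset.range l, (τ (j + 1) - τ j) = b - a := by
  rw [Finset.sum_range_sub, hp.2.1, hp.2.2.1]

lemma sq_intervalIntegral_le {f : ℝ → ℝ} {s t : ℝ} (hst : s ≤ t)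
    (h1 : IntervalIntegrable f volume s t) (h2 : IntervalIntegrable (fun u => f u ^ 2) volume s t) :
    (∫ u in s..t, f u) ^ 2 ≤ (t - s) * ∫ u in s..t, f u ^ 2 := by
  rcases hst.eq_or_lt with rfl | hlt
  · simp
  set I := ∫ u in s..t, f u with hI
  have hpos : 0 < t - s := sub_pos.2 hlt
  set c := I / (t - s) with hc
  have h0 : 0 ≤ ∫ u in s..t, (f u - c) ^ 2 :=
    intervalIntegral.integral_nonneg hst fun u _ => sq_nonneg _
  have h3 : ∫ u in s..t, (f u - c) ^ 2 = (∫ u in s..t, f u ^ 2) - 2 * c * I + c ^ 2 * (t - s) := by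
    have : (fun u => (f u - c) ^ 2) = fun u => (f u ^ 2 - 2 * c * f u) + c ^ 2 := by
      ext u; ring
    rw [this, intervalIntegral.integral_add (h2.sub (h1.const_mul _)) (by simp),
      intervalIntegral.integral_sub h2 (h1.const_mul _), intervalIntegral.integral_const_mul,
      intervalIntegral.integral_const, smul_eq_mul, hI]
    ring
  rw [h3] at h0
  have h4 : c * (t - s) = I := by rw [hc]; field_simp
  nlinarith

namespace IsL2Deriv

variable {γ : CPath a b n} {g : ℝ → Eu n}

lemma integrableOn (h : IsL2Deriv γ g) : IntegrableOn g (Set.Icc a b) :=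
  h.1.integrable (by norm_num)

lemma integrableOn_sq (h : IsL2Deriv γ g) : IntegrableOn (fun t => ‖g t‖ ^ 2) (Set.Icc a b) :=
  h.1.integrable_norm_pow (by norm_num)

lemma isACC (h : IsL2Deriv γ g) : IsACC γ := ⟨g, h.integrableOn, h.2⟩

lemma intervalIntegrable_sq (h : IsL2Deriv γ g) {s t : ℝ} (hs : s ∈ Set.Icc a b)
    (ht : t ∈ Set.Icc a b) : IntervalIntegrable (fun t => ‖g t‖ ^ 2) volume s t := by
  apply IntegrableOn.intervalIntegrable
  exact h.integrableOn_sq.mono_set (Set.uIcc_subset_Icc hs ht)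

lemma intervalIntegrable (h : IsL2Deriv γ g) {s t : ℝ} (hs : s ∈ Set.Icc a b)
    (ht : t ∈ Set.Icc a b) : IntervalIntegrable g volume s t := by
  apply IntegrableOn.intervalIntegrable
  exact h.integrableOn.mono_set (Set.uIcc_subset_Icc hs ht)

lemma norm_sub_sq_le (h : IsL2Deriv γ g) {s t : ℝ} (hs : s ∈ Set.Icc a b)
    (ht : t ∈ Set.Icc a b) (hst : s ≤ t) :
    ‖pev γ t - pev γ s‖ ^ 2 ≤ (t - s) * ∫ u in s..t, ‖g u‖ ^ 2 := by
  rw [pev_of_mem γ hs, pev_of_mem γ ht, h.2 ⟨s, hs⟩ ⟨t, ht⟩, add_sub_cancel_left]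
  calc ‖∫ u in s..t, g u‖ ^ 2 ≤ (∫ u in s..t, ‖g u‖) ^ 2 := by
        gcongr
        exact intervalIntegral.norm_integral_le_integral_norm hst
    _ ≤ _ := sq_intervalIntegral_le hst (h.intervalIntegrable hs ht).norm
        (h.intervalIntegrable_sq hs ht)

lemma intervalIntegral_sq_le (h : IsL2Deriv γ g) {s t : ℝ} (hs : s ∈ Set.Icc a b)
    (ht : t ∈ Set.Icc a b) (hst : s ≤ t) :
    ∫ u in s..t, ‖g u‖ ^ 2 ≤ ∫ u in Set.Icc a b, ‖g u‖ ^ 2 := by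
  rw [intervalIntegral.integral_of_le hst]
  exact setIntegral_mono_set h.integrableOn_sq (Eventually.of_forall fun u => by positivity)
    (Set.Ioc_subset_Icc_self.trans (Set.Icc_subset_Icc hs.1 ht.2)).eventuallyLE

/-- The `1/2`-Hölder estimate for curves of finite energy. -/
lemma norm_sub_sq_le_energy (h : IsL2Deriv γ g) {s t : ℝ} (hs : s ∈ Set.Icc a b)
    (ht : t ∈ Set.Icc a b) :
    ‖pev γ t - pev γ s‖ ^ 2 ≤ |t - s| * ∫ u in Set.Icc a b, ‖g u‖ ^ 2 := by
  rcases le_total s t with hst | hst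
  · rw [abs_of_nonneg (sub_nonneg.2 hst)]
    exact (h.norm_sub_sq_le hs ht hst).trans
      (mul_le_mul_of_nonneg_left (h.intervalIntegral_sq_le hs ht hst) (sub_nonneg.2 hst))
  · rw [abs_sub_comm, norm_sub_rev, abs_of_nonneg (sub_nonneg.2 hst)]
    exact (h.norm_sub_sq_le ht hs hst).trans
      (mul_le_mul_of_nonneg_left (h.intervalIntegral_sq_le ht hs hst) (sub_nonneg.2 hst))

lemma discreteKinetic_le (h : IsL2Deriv γ g) {τ : ℕ → ℝ} {l : ℕ} {δ : ℝ}
    (hp : IsPartition a b τ l δ) :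
    discreteKinetic τ l γ ≤ ∫ u in Set.Icc a b, ‖g u‖ ^ 2 := by
  have hab : a ≤ b := by
    have := hp.monotoneOn (Nat.zero_le l) le_rfl
    rwa [hp.2.1, hp.2.2.1] at this
  rw [integral_Icc_eq_integral_Ioc, ← intervalIntegral.integral_of_le hab]
  have := intervalIntegral.sum_integral_adjacent_intervals (μ := volume)
    (f := fun t => ‖g t‖ ^ 2) (a := τ) (n := l)
    fun k hk => h.intervalIntegrable_sq (hp.mem_Icc hk.le) (hp.mem_Icc hk)
  rw [hp.2.1, hp.2.2.1] at this
  rw [← this]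
  refine Finset.sum_le_sum fun j hj => ?_
  have hj := Finset.mem_range.1 hj
  have hlt := hp.2.2.2.1 j hj
  rw [div_le_iff₀ (sub_pos.2 hlt), mul_comm]
  exact h.norm_sub_sq_le (hp.mem_Icc hj.le) (hp.mem_Icc hj) hlt.le

end IsL2Deriv

lemma ae_eq_of_isACC_rep {γ : CPath a b n} {g g' : ℝ → Eu n}
    (hg : IntegrableOn g (Set.Icc a b)) (hg' : IntegrableOn g' (Set.Icc a b))
    (h : ∀ s t : Set.Icc a b, γ t = γ s + ∫ u in (s : ℝ)..(t : ℝ), g u)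
    (h' : ∀ s t : Set.Icc a b, γ t = γ s + ∫ u in (s : ℝ)..(t : ℝ), g' u) :
    g =ᵐ[volume.restrict (Set.Icc a b)] g' := by
  rcases lt_or_ge b a with hab | hab
  · simp [Set.Icc_eq_empty (not_le.2 hab), Filter.EventuallyEq]
  have hi : IntervalIntegrable g volume a b :=
    IntegrableOn.intervalIntegrable (by rwa [Set.uIcc_of_le hab])
  have hi' : IntervalIntegrable g' volume a b :=
    IntegrableOn.intervalIntegrable (by rwa [Set.uIcc_of_le hab])
  rw [← restrict_Ioo_eq_restrict_Icc, Filter.EventuallyEq, ae_restrict_iff' measurableSet_Ioo]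
  filter_upwards [hi.ae_hasDerivAt_integral, hi'.ae_hasDerivAt_integral] with t h1 h2 ht
  have htI := Set.Ioo_subset_Icc_self ht
  rw [Set.uIcc_of_le hab] at h1 h2
  have d1 := h1 htI a ⟨le_rfl, hab⟩
  have d2 := h2 htI a ⟨le_rfl, hab⟩
  refine d1.unique (d2.congr_of_eventuallyEq ?_)
  filter_upwards [isOpen_Ioo.mem_nhds ht] with u hu
  have e := (h ⟨a, le_rfl, hab⟩ ⟨u, Set.Ioo_subset_Icc_self hu⟩).symm.trans
    (h' ⟨a, le_rfl, hab⟩ ⟨u, Set.Ioo_subset_Icc_self hu⟩)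
  exact add_left_cancel e

end PathEnergy

section PathEnergyCompactness

variable {a b : ℝ} {n : ℕ}

/-- A piecewise affine curve has a square-integrable derivative, whose energy is the discrete
kinetic energy. -/
lemma PiecewiseAffine.exists_isL2Deriv {τ : ℕ → ℝ} {l : ℕ} {δ : ℝ}
    (hp : IsPartition a b τ l δ) {γ : CPath a b n} (hγ : PiecewiseAffine a b τ l γ) :
    ∃ g, IsL2Deriv γ g ∧ ∫ u in Set.Icc a b, ‖g u‖ ^ 2 = discreteKinetic τ l γ := by
  have hab : a ≤ b := by
    have := hp.monotoneOn (Nat.zero_le l) le_rfl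
    rwa [hp.2.1, hp.2.2.1] at this
  set v : ℕ → Eu n := fun j => (τ (j + 1) - τ j)⁻¹ • (pev γ (τ (j + 1)) - pev γ (τ j)) with hv
  set g : ℝ → Eu n := fun t =>
    ∑ j ∈ Finset.range l, (Set.Ioc (τ j) (τ (j + 1))).indicator (fun _ => v j) t with hg
  have gval : ∀ j < l, ∀ t ∈ Set.Ioc (τ j) (τ (j + 1)), g t = v j := by
    intro j hj t ht
    rw [hg]
    simp only
    rw [Finset.sum_eq_single j, Set.indicator_of_mem ht]
    · intro i hi hij
      refine Set.indicator_of_notMem ?_ _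
      rintro ⟨h1, h2⟩
      rcases lt_or_gt_of_ne hij with hlt | hlt
      · exact absurd (h2.trans (hp.monotoneOn hlt hj.le)) (not_le.2 ht.1)
      · exact absurd (ht.2.trans (hp.monotoneOn hlt (Finset.mem_range.1 hi).le)) (not_le.2 h1)
    · intro h
      exact absurd (Finset.mem_range.2 hj) h
  have gLp : MemLp g 2 (volume.restrict (Set.Icc a b)) :=
    memLp_finsetSum _ fun j _ => memLp_indicator_const 2 measurableSet_Ioc _
      (Or.inr (measure_ne_top _ _))
  have gInt : IntegrableOn g (Set.Icc a b) := gLp.integrable (by norm_num)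
  have gII : ∀ s ∈ Set.Icc a b, ∀ t ∈ Set.Icc a b, IntervalIntegrable g volume s t :=
    fun s hs t ht => IntegrableOn.intervalIntegrable (gInt.mono_set (Set.uIcc_subset_Icc hs ht))
  have haI : a ∈ Set.Icc a b := ⟨le_rfl, hab⟩
  have rep0 : ∀ j ≤ l, ∀ t ∈ Set.Icc a (τ j), pev γ t = pev γ a + ∫ u in a..t, g u := by
    intro j
    induction j with
    | zero =>
      intro _ t ht
      rw [hp.2.1] at ht
      have : t = a := le_antisymm ht.2 ht.1
      simp [this]
    | succ j ih =>
      intro hj t ht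
      rcases le_or_gt t (τ j) with h1 | h1
      · exact ih (by omega) t ⟨ht.1, h1⟩
      have hjI := hp.mem_Icc (show j ≤ l by omega)
      have hjI' := hp.mem_Icc hj
      have htI : t ∈ Set.Icc a b := ⟨ht.1, ht.2.trans hjI'.2⟩
      have e1 := ih (by omega) (τ j) ⟨hjI.1, le_rfl⟩
      have e2 := hγ j (by omega) ⟨t, htI⟩ ⟨h1.le, ht.2⟩
      rw [← pev_of_mem γ htI] at e2
      have e3 : ∫ u in (τ j)..t, g u = (t - τ j) • v j := by
        rw [← intervalIntegral.integral_const]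
        refine intervalIntegral.integral_congr_ae (Eventually.of_forall fun u hu => ?_)
        rw [Set.uIoc_of_le h1.le] at hu
        exact gval j (by omega) u ⟨hu.1, hu.2.trans ht.2⟩
      rw [← intervalIntegral.integral_add_adjacent_intervals (gII a haI _ hjI) (gII _ hjI t htI),
        ← add_assoc, ← e1, e3, e2, hv]
      simp only [smul_smul, div_eq_mul_inv]
  have rep : ∀ s t : Set.Icc a b, γ t = γ s + ∫ u in (s : ℝ)..(t : ℝ), g u := by
    intro s t
    have es := rep0 l le_rfl s (by rw [hp.2.2.1]; exact s.2)
    have et := rep0 l le_rfl t (by rw [hp.2.2.1]; exact t.2)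
    rw [pev_of_mem γ s.2] at es
    rw [pev_of_mem γ t.2] at et
    rw [et, es, add_assoc, intervalIntegral.integral_add_adjacent_intervals (gII a haI _ s.2)
      (gII _ s.2 _ t.2)]
  have hD : IsL2Deriv γ g := ⟨gLp, rep⟩
  refine ⟨g, hD, ?_⟩
  rw [integral_Icc_eq_integral_Ioc, ← intervalIntegral.integral_of_le hab]
  have := intervalIntegral.sum_integral_adjacent_intervals (μ := volume)
    (f := fun t => ‖g t‖ ^ 2) (a := τ) (n := l)
    fun k hk => hD.intervalIntegrable_sq (hp.mem_Icc hk.le) (hp.mem_Icc hk)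
  rw [hp.2.1, hp.2.2.1] at this
  rw [← this]
  refine Finset.sum_congr rfl fun j hj => ?_
  have hj := Finset.mem_range.1 hj
  have hlt := sub_pos.2 (hp.2.2.2.1 j hj)
  have : ∫ u in (τ j)..(τ (j + 1)), ‖g u‖ ^ 2 = ∫ u in (τ j)..(τ (j + 1)), ‖v j‖ ^ 2 := by
    refine intervalIntegral.integral_congr_ae (Eventually.of_forall fun u hu => ?_)
    rw [Set.uIoc_of_le (sub_pos.1 hlt).le] at hu
    rw [gval j hj u hu]
  rw [this, intervalIntegral.integral_const, hv, smul_eq_mul, norm_smul, Real.norm_eq_abs,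
    abs_of_pos (inv_pos.2 hlt)]
  field_simp

/-- Pointwise limits of curves of bounded energy have a square-integrable derivative, with the
same energy bound. -/
lemma exists_isL2Deriv_of_tendsto {ι : Type*} {F : Filter ι} [F.NeBot] {γs : ι → CPath a b n}
    {gs : ι → ℝ → Eu n} (hgs : ∀ i, IsL2Deriv (γs i) (gs i)) {M : ℝ}
    (hM : ∀ᶠ i in F, ∫ u in Set.Icc a b, ‖gs i u‖ ^ 2 ≤ M) {γ : CPath a b n}
    (hγ : ∀ t, Tendsto (fun i => γs i t) F (𝓝 (γ t))) :
    ∃ g, IsL2Deriv γ g ∧ ∫ u in Set.Icc a b, ‖g u‖ ^ 2 ≤ M := by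
  set μ : Measure ℝ := volume.restrict (Set.Icc a b) with hμ
  have normsq : ∀ G : Lp (Eu n) 2 μ, ‖G‖ ^ 2 = ∫ u, ‖G u‖ ^ 2 ∂μ := by
    intro G
    rw [← real_inner_self_eq_norm_sq, L2.inner_def]
    simp only [real_inner_self_eq_norm_sq]
  let G : ι → Lp (Eu n) 2 μ := fun i => (hgs i).1.toLp (gs i)
  have hGae : ∀ i, G i =ᵐ[μ] gs i := fun i => MemLp.coeFn_toLp _
  have hGn : ∀ᶠ i in F, ‖G i‖ ≤ Real.sqrt M := by
    filter_upwards [hM] with i hi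
    refine Real.le_sqrt_of_sq_le ?_
    rw [normsq, integral_congr_ae ((hGae i).mono fun u hu => by rw [hu])]
    exact hi
  have M0 : 0 ≤ M := by
    obtain ⟨i, hi⟩ := hM.exists
    exact (integral_nonneg fun u => by positivity).trans hi
  let W : ι → WeakDual ℝ (Lp (Eu n) 2 μ) := fun i =>
    StrongDual.toWeakDual (InnerProductSpace.toDual ℝ _ (G i))
  let U := Ultrafilter.of F
  obtain ⟨x, hxK, hx⟩ := (WeakDual.isCompact_closedBall (𝕜 := ℝ) (E := Lp (Eu n) 2 μ) 0
    (Real.sqrt M)).ultrafilter_le_nhds (U.map W) (by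
      rw [le_principal_iff]
      refine (Ultrafilter.of_le F) ?_
      filter_upwards [hGn] with i hi
      simpa [W] using hi)
  let G₀ : Lp (Eu n) 2 μ := (InnerProductSpace.toDual ℝ _).symm (WeakDual.toStrongDual x)
  have hG₀ : ‖G₀‖ ≤ Real.sqrt M := by simpa [G₀] using hxK
  have hlim : ∀ y : Lp (Eu n) 2 μ, Tendsto (fun i => inner ℝ (G i) y) U (𝓝 (inner ℝ G₀ y)) := by
    intro y
    have h1 : Tendsto W U (𝓝 x) := hx
    have h2 := ((WeakDual.eval_continuous y).tendsto x).comp h1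
    have h3 : inner ℝ G₀ y = x y := by simp [G₀]
    rw [h3]
    exact h2
  refine ⟨G₀, ⟨Lp.memLp G₀, ?_⟩, ?_⟩
  · have key : ∀ s t : Set.Icc a b, (s : ℝ) ≤ t → γ t = γ s + ∫ u in (s : ℝ)..(t : ℝ), G₀ u := by
      intro s t hst
      have hsub : Set.Ioc (s : ℝ) t ⊆ Set.Icc a b :=
        Set.Ioc_subset_Icc_self.trans (Set.Icc_subset_Icc s.2.1 t.2.2)
      have hres : μ.restrict (Set.Ioc (s : ℝ) t) = volume.restrict (Set.Ioc (s : ℝ) t) :=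
        Measure.restrict_restrict_of_subset hsub
      rw [← sub_eq_iff_eq_add']
      refine ext_inner_left ℝ fun c => ?_
      have e : ∀ H : Lp (Eu n) 2 μ, inner ℝ H
          (indicatorConstLp 2 (measurableSet_Ioc (a := (s : ℝ)) (b := t)) (measure_ne_top μ _) c) =
          inner ℝ c (∫ u in (s : ℝ)..(t : ℝ), H u) := by
        intro H
        rw [real_inner_comm, L2.inner_indicatorConstLp_eq_inner_setIntegral, hres,
          intervalIntegral.integral_of_le hst]
      have h1 := hlim (indicatorConstLp 2 (measurableSet_Ioc (a := (s : ℝ)) (b := t))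
        (measure_ne_top μ _) c)
      simp only [e] at h1
      have h2 : ∀ i, ∫ u in (s : ℝ)..(t : ℝ), G i u = γs i t - γs i s := by
        intro i
        rw [(hgs i).2 s t, add_sub_cancel_left, intervalIntegral.integral_of_le hst,
          intervalIntegral.integral_of_le hst, ← hres]
        exact integral_congr_ae (ae_restrict_of_ae (hGae i))
      simp only [h2] at h1
      refine tendsto_nhds_unique ?_ h1
      exact (tendsto_const_nhds.inner ((hγ t).sub (hγ s))).mono_left (Ultrafilter.of_le F)
    intro s t
    rcases le_total (s : ℝ) t with hst | hst
    · exact key s t hst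
    · rw [intervalIntegral.integral_symm, key t s hst]
      abel
  · change ∫ u, ‖G₀ u‖ ^ 2 ∂μ ≤ M
    rw [← normsq]
    calc ‖G₀‖ ^ 2 ≤ Real.sqrt M ^ 2 := by gcongr
      _ = M := Real.sq_sqrt M0

end PathEnergyCompactness

section Interpolation

variable {a b : ℝ} {n : ℕ}

/-- The piecewise affine interpolation of a curve along a partition. -/
noncomputable def interp (τ : ℕ → ℝ) (l : ℕ) (γ : CPath a b n) : CPath a b n where
  toFun t := pev γ (τ 0) + ∑ j ∈ Finset.range l,
    max 0 (min 1 (((t : ℝ) - τ j) / (τ (j + 1) - τ j))) •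
      (pev γ (τ (j + 1)) - pev γ (τ j))
  continuous_toFun := by fun_prop

lemma interp_apply {τ : ℕ → ℝ} {l : ℕ} {δ : ℝ} (hp : IsPartition a b τ l δ)
    (γ : CPath a b n) {j : ℕ} (hj : j < l) (t : Set.Icc a b)
    (ht : (t : ℝ) ∈ Set.Icc (τ j) (τ (j + 1))) :
    interp τ l γ t = pev γ (τ j) + (((t : ℝ) - τ j) / (τ (j + 1) - τ j)) •
      (pev γ (τ (j + 1)) - pev γ (τ j)) := by
  obtain ⟨k, rfl⟩ := Nat.exists_eq_add_of_lt hj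
  change pev γ (τ 0) + ∑ i ∈ Finset.range (j + k + 1), _ = _
  rw [show j + k + 1 = (j + 1) + k by ring, Finset.sum_range_add, Finset.sum_range_succ]
  have h1 : ∀ i ∈ Finset.range j, max 0 (min 1 (((t : ℝ) - τ i) / (τ (i + 1) - τ i))) •
      (pev γ (τ (i + 1)) - pev γ (τ i)) = pev γ (τ (i + 1)) - pev γ (τ i) := by
    intro i hi
    have hi := Finset.mem_range.1 hi
    have hlt := sub_pos.2 (hp.2.2.2.1 i (by omega))
    have : 1 ≤ ((t : ℝ) - τ i) / (τ (i + 1) - τ i) := by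
      rw [one_le_div hlt]
      have := hp.monotoneOn (show i + 1 ≤ j by omega) (by omega)
      linarith [ht.1]
    rw [min_eq_left this, max_eq_right zero_le_one, one_smul]
  have h2 : ∀ i ∈ Finset.range k,
      max 0 (min 1 (((t : ℝ) - τ (j + 1 + i)) / (τ (j + 1 + i + 1) - τ (j + 1 + i)))) •
      (pev γ (τ (j + 1 + i + 1)) - pev γ (τ (j + 1 + i))) = 0 := by
    intro i hi
    have hi := Finset.mem_range.1 hi
    have hlt := sub_pos.2 (hp.2.2.2.1 (j + 1 + i) (by omega))
    have : ((t : ℝ) - τ (j + 1 + i)) / (τ (j + 1 + i + 1) - τ (j + 1 + i)) ≤ 0 := by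
      apply div_nonpos_of_nonpos_of_nonneg _ hlt.le
      have := hp.monotoneOn (show j + 1 ≤ j + 1 + i by omega) (by omega)
      linarith [ht.2]
    rw [max_eq_left ((min_le_right _ _).trans this), zero_smul]
  rw [Finset.sum_congr rfl h1, Finset.sum_congr rfl h2,
    Finset.sum_range_sub (fun i => pev γ (τ i)), Finset.sum_const_zero]
  have hlt := sub_pos.2 (hp.2.2.2.1 j hj)
  have h3 : ((t : ℝ) - τ j) / (τ (j + 1) - τ j) ≤ 1 := by
    rw [div_le_one hlt]
    linarith [ht.2]
  have h4 : 0 ≤ ((t : ℝ) - τ j) / (τ (j + 1) - τ j) :=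
    div_nonneg (by linarith [ht.1]) hlt.le
  rw [min_eq_right h3, max_eq_right h4]
  abel

lemma IsPartition.exists_mem_Icc {τ : ℕ → ℝ} {l : ℕ} {δ : ℝ} (hp : IsPartition a b τ l δ)
    {t : ℝ} (ht : t ∈ Set.Icc a b) : ∃ j < l, t ∈ Set.Icc (τ j) (τ (j + 1)) := by
  have key : ∀ k, 1 ≤ k → k ≤ l → t ∈ Set.Icc a (τ k) →
      ∃ j < k, t ∈ Set.Icc (τ j) (τ (j + 1)) := by
    intro k hk
    induction k, hk using Nat.le_induction with
    | base =>
      intro _ h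
      exact ⟨0, by omega, by rw [hp.2.1]; exact h⟩
    | succ k hk ih =>
      intro hkl h
      rcases le_total t (τ k) with h1 | h1
      · obtain ⟨j, hj, h2⟩ := ih (by omega) ⟨h.1, h1⟩
        exact ⟨j, by omega, h2⟩
      · exact ⟨k, by omega, h1, h.2⟩
  exact key l hp.1 le_rfl (by rw [hp.2.2.1]; exact ht)

lemma pev_interp {τ : ℕ → ℝ} {l : ℕ} {δ : ℝ} (hp : IsPartition a b τ l δ)
    (γ : CPath a b n) {j : ℕ} (hj : j ≤ l) : pev (interp τ l γ) (τ j) = pev γ (τ j) := by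
  rw [pev_of_mem _ (hp.mem_Icc hj)]
  rcases Nat.lt_or_ge j l with h | h
  · rw [interp_apply hp γ h ⟨τ j, _⟩ ⟨le_rfl, (hp.2.2.2.1 j h).le⟩]
    simp
  · obtain rfl : j = l := le_antisymm hj h
    obtain ⟨k, rfl⟩ := Nat.exists_eq_add_of_le' hp.1
    have hlt := hp.2.2.2.1 k (by omega)
    rw [interp_apply hp γ (show k < k + 1 by omega) ⟨τ (k + 1), _⟩ ⟨hlt.le, le_rfl⟩]
    have : τ (k + 1) - τ k ≠ 0 := (sub_pos.2 hlt).ne'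
    simp [div_self this]

lemma piecewiseAffine_interp {τ : ℕ → ℝ} {l : ℕ} {δ : ℝ} (hp : IsPartition a b τ l δ)
    (γ : CPath a b n) : PiecewiseAffine a b τ l (interp τ l γ) := by
  intro j hj t ht
  rw [pev_interp hp γ hj.le, pev_interp hp γ hj, interp_apply hp γ hj t ht]

lemma discreteKinetic_interp {τ : ℕ → ℝ} {l : ℕ} {δ : ℝ} (hp : IsPartition a b τ l δ)
    (γ : CPath a b n) : discreteKinetic τ l (interp τ l γ) = discreteKinetic τ l γ := by
  refine Finset.sum_congr rfl fun j hj => ?_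
  have hj := Finset.mem_range.1 hj
  rw [pev_interp hp γ hj.le, pev_interp hp γ hj]

lemma discretePotential_interp (V : Eu n → ℝ) {τ : ℕ → ℝ} {l : ℕ} {δ : ℝ}
    (hp : IsPartition a b τ l δ) (γ : CPath a b n) :
    discretePotential V τ l (interp τ l γ) = discretePotential V τ l γ := by
  refine Finset.sum_congr rfl fun j hj => ?_
  have hj := Finset.mem_range.1 hj
  rw [pev_interp hp γ hj.le, pev_interp hp γ hj]

lemma continuous_interp (τ : ℕ → ℝ) (l : ℕ) :
    Continuous (interp τ l : CPath a b n → CPath a b n) := by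
  refine ContinuousMap.continuous_of_continuous_uncurry _ ?_
  have h := fun j => (continuous_pev_left (a := a) (b := b) (n := n) (τ j)).comp
    (continuous_fst (X := CPath a b n) (Y := Set.Icc a b))
  change Continuous fun p : CPath a b n × Set.Icc a b => pev p.1 (τ 0) +
    ∑ j ∈ Finset.range l, max 0 (min 1 (((p.2 : ℝ) - τ j) / (τ (j + 1) - τ j))) •
      (pev p.1 (τ (j + 1)) - pev p.1 (τ j))
  refine (h 0).add (continuous_finsetSum _ fun j _ => ?_)
  have h1 : Continuous fun p : CPath a b n × Set.Icc a b =>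
      max 0 (min 1 (((p.2 : ℝ) - τ j) / (τ (j + 1) - τ j))) := by fun_prop
  exact h1.smul ((h (j + 1)).sub (h j))

lemma dist_interp_le {τ : ℕ → ℝ} {l : ℕ} {δ : ℝ} (hp : IsPartition a b τ l δ)
    (γ : CPath a b n) {η : ℝ} (hη : 0 ≤ η)
    (hγ : ∀ s t : Set.Icc a b, |(s : ℝ) - t| ≤ δ → dist (γ s) (γ t) ≤ η) :
    dist (interp τ l γ) γ ≤ η := by
  rw [ContinuousMap.dist_le hη]
  intro t
  obtain ⟨j, hj, ht⟩ := hp.exists_mem_Icc t.2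
  have hlt := sub_pos.2 (hp.2.2.2.1 j hj)
  have hδ := hp.2.2.2.2 j hj
  rw [interp_apply hp γ hj t ht, pev_of_mem γ (hp.mem_Icc hj.le), pev_of_mem γ (hp.mem_Icc hj)]
  set θ := ((t : ℝ) - τ j) / (τ (j + 1) - τ j) with hθ
  have h0 : 0 ≤ θ := div_nonneg (by linarith [ht.1]) hlt.le
  have h1 : θ ≤ 1 := by
    rw [hθ, div_le_one hlt]
    linarith [ht.2]
  have d1 := hγ ⟨τ j, hp.mem_Icc hj.le⟩ t (by
    rw [abs_le]
    constructor <;> simp only <;> linarith [ht.1, ht.2])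
  have d2 := hγ ⟨τ (j + 1), hp.mem_Icc hj⟩ t (by
    rw [abs_le]
    constructor <;> simp only <;> linarith [ht.1, ht.2])
  rw [← Metric.mem_closedBall] at d1 d2 ⊢
  have := (convex_closedBall (γ t) η) d1 d2 (sub_nonneg.2 h1) h0 (by ring)
  convert this using 1
  module

/-- The uniform partition of `[a,b]` into `j + 1` intervals. -/
noncomputable def uniformGrid (a b : ℝ) (j i : ℕ) : ℝ := a + i * ((b - a) / (j + 1))

lemma isPartition_uniformGrid (hab : a < b) (j : ℕ) :
    IsPartition a b (uniformGrid a b j) (j + 1) ((b - a) / (j + 1)) := by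
  have h : 0 < (b - a) / ((j : ℝ) + 1) := div_pos (sub_pos.2 hab) (by positivity)
  have e : ∀ i, uniformGrid a b j (i + 1) - uniformGrid a b j i = (b - a) / (j + 1) := by
    intro i
    simp only [uniformGrid]
    push_cast
    ring
  refine ⟨by omega, by simp [uniformGrid], ?_, fun i _ => ?_, fun i _ => (e i).le⟩
  · simp only [uniformGrid]
    push_cast
    field_simp
    ring
  · rw [← sub_pos, e]
    exact h

lemma exists_modulus (γ : CPath a b n) {η : ℝ} (hη : 0 < η) :
    ∃ δ > 0, ∀ s t : Set.Icc a b, |(s : ℝ) - t| ≤ δ → dist (γ s) (γ t) ≤ η := by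
  have hu := CompactSpace.uniformContinuous_of_continuous γ.continuous
  obtain ⟨δ, hδ, h⟩ := Metric.uniformContinuous_iff.1 hu η hη
  refine ⟨δ / 2, by positivity, fun s t hst => (h ?_).le⟩
  rw [Subtype.dist_eq, Real.dist_eq]
  linarith

/-- Interpolations along partitions of vanishing mesh converge uniformly. -/
lemma tendsto_interp {ι : Type*} {F : Filter ι} {τ : ι → ℕ → ℝ} {l : ι → ℕ} {h : ι → ℝ}
    (hp : ∀ i, IsPartition a b (τ i) (l i) (h i)) (hh : Tendsto h F (𝓝 0)) (γ : CPath a b n) :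
    Tendsto (fun i => interp (τ i) (l i) γ) F (𝓝 γ) := by
  rw [Metric.tendsto_nhds]
  intro ε hε
  obtain ⟨δ, hδ, H⟩ := exists_modulus γ (half_pos hε)
  filter_upwards [hh.eventually (gt_mem_nhds hδ)] with i hi
  refine lt_of_le_of_lt (dist_interp_le (hp i) γ (half_pos hε).le fun s t hst => ?_)
    (half_lt_self hε)
  exact H s t (hst.trans hi.le)

lemma tendsto_uniformGrid_mesh (a b : ℝ) :
    Tendsto (fun j : ℕ => (b - a) / ((j : ℝ) + 1)) atTop (𝓝 0) :=
  (tendsto_add_atTop_iff_nat (f := fun j : ℕ => (b - a) / (j : ℝ)) 1).2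
    (tendsto_const_div_atTop_nhds_zero_nat _) |>.congr fun j => by simp

/-- The kinetic energy along the uniform grid. -/
noncomputable def gridKinetic (γ : CPath a b n) (j : ℕ) : ℝ :=
  discreteKinetic (uniformGrid a b j) (j + 1) γ

lemma exists_isL2Deriv_of_frequently (hab : a < b) {γ : CPath a b n} {M : ℝ}
    (hM : ∃ᶠ j in atTop, gridKinetic γ j ≤ M) :
    ∃ g, IsL2Deriv γ g ∧ ∫ u in Set.Icc a b, ‖g u‖ ^ 2 ≤ M := by
  have hne : (atTop ⊓ 𝓟 {j | gridKinetic γ j ≤ M}).NeBot :=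
    frequently_iff_neBot.1 hM
  choose gs hgs hE using fun j => PiecewiseAffine.exists_isL2Deriv
    (isPartition_uniformGrid hab j) (piecewiseAffine_interp (isPartition_uniformGrid hab j) γ)
  refine exists_isL2Deriv_of_tendsto (F := atTop ⊓ 𝓟 {j | gridKinetic γ j ≤ M}) hgs ?_ ?_
  · rw [eventually_inf_principal]
    refine Eventually.of_forall fun j hj => ?_
    rw [hE, discreteKinetic_interp (isPartition_uniformGrid hab j)]
    exact hj
  · intro t
    have h1 := tendsto_interp (fun j => isPartition_uniformGrid hab j)
      (tendsto_uniformGrid_mesh a b) γ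
    have h2 := ((continuous_eval_const t).tendsto γ).comp h1
    exact h2.mono_left inf_le_left

lemma IsL2Deriv.tendsto_gridKinetic (hab : a < b) {γ : CPath a b n} {g : ℝ → Eu n}
    (hg : IsL2Deriv γ g) :
    Tendsto (gridKinetic γ) atTop (𝓝 (∫ u in Set.Icc a b, ‖g u‖ ^ 2)) := by
  have hup : ∀ j, gridKinetic γ j ≤ ∫ u in Set.Icc a b, ‖g u‖ ^ 2 := fun j =>
    hg.discreteKinetic_le (isPartition_uniformGrid hab j)
  rw [tendsto_order]
  refine ⟨fun M hM => ?_, fun M hM => Eventually.of_forall fun j => (hup j).trans_lt hM⟩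
  by_contra hcon
  have hfr : ∃ᶠ j in atTop, gridKinetic γ j ≤ M := by
    simpa [Filter.Frequently] using hcon
  obtain ⟨g', hg', hle⟩ := exists_isL2Deriv_of_frequently hab hfr
  have hae := ae_eq_of_isACC_rep hg.integrableOn hg'.integrableOn hg.2 hg'.2
  have : ∫ u in Set.Icc a b, ‖g u‖ ^ 2 = ∫ u in Set.Icc a b, ‖g' u‖ ^ 2 :=
    integral_congr_ae (hae.mono fun u hu => by simp only [hu])
  linarith

lemma tendsto_gridKinetic_atTop (hab : a < b) {γ : CPath a b n}
    (hγ : ¬ ∃ g, IsL2Deriv γ g) : Tendsto (gridKinetic γ) atTop atTop := by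
  rw [tendsto_atTop]
  intro M
  by_contra hcon
  have hfr : ∃ᶠ j in atTop, gridKinetic γ j ≤ M := by
    refine Frequently.mono (not_eventually.1 hcon) fun j hj => (not_le.1 hj).le
  obtain ⟨g, hg, -⟩ := exists_isL2Deriv_of_frequently hab hfr
  exact hγ ⟨g, hg⟩

lemma IsL2Deriv.action_eq {m : ℝ} {V : Eu n → ℝ} (hV : Continuous V) {L : Eu n → Eu n → ℝ}
    (hL : ∀ x v : Eu n, L x v = m / 2 * ‖v‖ ^ 2 - V x) {γ : CPath a b n} {g : ℝ → Eu n}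
    (hg : IsL2Deriv γ g) :
    action L a b γ = ((m / 2 * (∫ u in Set.Icc a b, ‖g u‖ ^ 2) - potential V γ : ℝ) : EReal) := by
  have hacc := hg.isACC
  obtain ⟨hgi, hgr⟩ := hacc.choose_spec
  have hae := ae_eq_of_isACC_rep hg.integrableOn hgi hg.2 hgr
  have hVi : IntegrableOn (fun t => V (pev γ t)) (Set.Icc a b) :=
    (hV.comp_continuousOn (continuousOn_pev γ)).integrableOn_compact isCompact_Icc
  have hEi := hg.integrableOn_sq.const_mul (m / 2)
  have hLae : (fun t => L (pev γ t) (hacc.choose t)) =ᵐ[volume.restrict (Set.Icc a b)]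
      fun t => m / 2 * ‖g t‖ ^ 2 - V (pev γ t) :=
    hae.mono fun u hu => by simp only [hL, hu]
  have hint : IntegrableOn (fun t => L (pev γ t) (hacc.choose t)) (Set.Icc a b) :=
    (hEi.sub hVi).congr hLae.symm
  rw [action, dif_pos hacc, if_pos hint, integral_congr_ae hLae, integral_sub hEi hVi,
    integral_const_mul]
  rfl

lemma action_eq_top {m : ℝ} (hm : 0 < m) {V : Eu n → ℝ} (hV : Continuous V)
    {L : Eu n → Eu n → ℝ} (hL : ∀ x v : Eu n, L x v = m / 2 * ‖v‖ ^ 2 - V x) {γ : CPath a b n}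
    (hγ : ¬ ∃ g, IsL2Deriv γ g) : action L a b γ = ⊤ := by
  rw [action]
  split_ifs with hacc hint
  · exfalso
    obtain ⟨hgi, hgr⟩ := hacc.choose_spec
    have hVi : IntegrableOn (fun t => V (pev γ t)) (Set.Icc a b) :=
      (hV.comp_continuousOn (continuousOn_pev γ)).integrableOn_compact isCompact_Icc
    refine hγ ⟨hacc.choose, ?_, hgr⟩
    rw [memLp_two_iff_integrable_sq_norm hgi.aestronglyMeasurable]
    refine ((hint.add hVi).const_mul (2 / m)).congr (Eventually.of_forall fun u => ?_)
    simp only [Pi.add_apply, hL]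
    field_simp
    ring
  · rfl
  · rfl

end Interpolation

section Potential

variable {a b : ℝ} {n : ℕ}

lemma norm_midpoint_sq_le {E : Type*} [NormedAddCommGroup E] [NormedSpace ℝ E] {x y : E} {B : ℝ}
    (hx : ‖x‖ ^ 2 ≤ B) (hy : ‖y‖ ^ 2 ≤ B) : ‖(2 : ℝ)⁻¹ • (x + y)‖ ^ 2 ≤ B := by
  have h1 : ‖(2 : ℝ)⁻¹ • (x + y)‖ ≤ 2⁻¹ * (‖x‖ + ‖y‖) := by
    rw [norm_smul]
    simpa using norm_add_le x y
  have h2 : ‖(2 : ℝ)⁻¹ • (x + y)‖ ^ 2 ≤ (2⁻¹ * (‖x‖ + ‖y‖)) ^ 2 := by gcongr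
  nlinarith [sq_nonneg (‖x‖ - ‖y‖)]

/-- The potential term is dominated by half the kinetic energy, up to a constant. -/
lemma exists_potential_bound (hab : a < b) {m : ℝ} (hm : 0 < m) {V : Eu n → ℝ} {c₂ : ℝ}
    (hc₂ : 0 < c₂) (hV2 : ∀ x : Eu n, |V x| ≤ c₂ * (1 + ‖x‖ ^ 2))
    (hVt : (∃ CV : ℝ, ∀ x, |V x| ≤ CV) ∨ b - a ≤ Real.sqrt (m / (32 * c₂))) (R : ℝ) :
    ∃ C, 0 ≤ C ∧ ∀ (x : Eu n) (E : ℝ), 0 ≤ E → ‖x‖ ^ 2 ≤ 2 * R ^ 2 + 2 * (b - a) * E →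
      |V x| * (b - a) ≤ m / 4 * E + C := by
  have hT : 0 < b - a := sub_pos.2 hab
  rcases hVt with ⟨CV, hCV⟩ | h
  · have h0 : 0 ≤ CV := (abs_nonneg _).trans (hCV 0)
    refine ⟨CV * (b - a), by positivity, fun x E hE _ => ?_⟩
    have : 0 ≤ m / 4 * E := by positivity
    nlinarith [hCV x]
  · refine ⟨c₂ * (1 + 2 * R ^ 2) * (b - a), by positivity, fun x E hE hx => ?_⟩
    have h2 : (b - a) ^ 2 ≤ m / (32 * c₂) := by
      rw [← Real.sq_sqrt (show 0 ≤ m / (32 * c₂) by positivity)]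
      gcongr
    rw [le_div_iff₀ (by positivity)] at h2
    calc |V x| * (b - a) ≤ c₂ * (1 + (2 * R ^ 2 + 2 * (b - a) * E)) * (b - a) := by
          gcongr
          exact (hV2 x).trans (by gcongr)
      _ = c₂ * (1 + 2 * R ^ 2) * (b - a) + (2 * (c₂ * (b - a) ^ 2)) * E := by ring
      _ ≤ c₂ * (1 + 2 * R ^ 2) * (b - a) + (m / 4) * E := by
          gcongr
          linarith
      _ = _ := by ring

lemma IsL2Deriv.norm_pev_sq_le {γ : CPath a b n} {g : ℝ → Eu n} (hg : IsL2Deriv γ g) (hab : a < b)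
    {R : ℝ} (hR : ‖pev γ a‖ ≤ R) (t : ℝ) :
    ‖pev γ t‖ ^ 2 ≤ 2 * R ^ 2 + 2 * (b - a) * ∫ u in Set.Icc a b, ‖g u‖ ^ 2 := by
  have hT : 0 < b - a := sub_pos.2 hab
  have hE : 0 ≤ ∫ u in Set.Icc a b, ‖g u‖ ^ 2 := integral_nonneg fun u => by positivity
  by_cases ht : t ∈ Set.Icc a b
  · have h1 := hg.norm_sub_sq_le_energy ⟨le_rfl, hab.le⟩ ht
    rw [abs_of_nonneg (sub_nonneg.2 ht.1)] at h1
    have h2 : ‖pev γ t‖ ≤ ‖pev γ t - pev γ a‖ + ‖pev γ a‖ := by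
      simpa using norm_add_le (pev γ t - pev γ a) (pev γ a)
    have h3 : (t - a) * (∫ u in Set.Icc a b, ‖g u‖ ^ 2) ≤
        (b - a) * ∫ u in Set.Icc a b, ‖g u‖ ^ 2 := by
      gcongr
      exact ht.2
    have h4 : ‖pev γ a‖ ^ 2 ≤ R ^ 2 := by gcongr
    have h5 : ‖pev γ t‖ ^ 2 ≤ (‖pev γ t - pev γ a‖ + ‖pev γ a‖) ^ 2 := by gcongr
    nlinarith [sq_nonneg (‖pev γ t - pev γ a‖ - ‖pev γ a‖)]
  · have : 0 ≤ 2 * R ^ 2 + 2 * (b - a) * ∫ u in Set.Icc a b, ‖g u‖ ^ 2 := by positivity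
    simpa [pev, ht] using this

lemma abs_discretePotential_le (V : Eu n → ℝ) {τ : ℕ → ℝ} {l : ℕ} {δ : ℝ}
    (hp : IsPartition a b τ l δ) (hab : a < b) {γ : CPath a b n} {B D : ℝ}
    (hB : ∀ t, ‖pev γ t‖ ^ 2 ≤ B) (hV : ∀ x : Eu n, ‖x‖ ^ 2 ≤ B → |V x| * (b - a) ≤ D) :
    |discretePotential V τ l γ| ≤ D := by
  have hT : 0 < b - a := sub_pos.2 hab
  calc |discretePotential V τ l γ| ≤ ∑ j ∈ Finset.range l, D / (b - a) * (τ (j + 1) - τ j) := by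
        refine (Finset.abs_sum_le_sum_abs _ _).trans (Finset.sum_le_sum fun j hj => ?_)
        have hlt := sub_pos.2 (hp.2.2.2.1 j (Finset.mem_range.1 hj))
        rw [abs_mul, abs_of_pos hlt]
        gcongr
        rw [le_div_iff₀ hT]
        exact hV _ (norm_midpoint_sq_le (hB _) (hB _))
    _ = D := by
        rw [← Finset.mul_sum, hp.sum_sub]
        field_simp

lemma abs_potential_le (V : Eu n → ℝ) (hab : a < b) {γ : CPath a b n} {B D : ℝ}
    (hB : ∀ t, ‖pev γ t‖ ^ 2 ≤ B) (hV : ∀ x : Eu n, ‖x‖ ^ 2 ≤ B → |V x| * (b - a) ≤ D) :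
    |potential V γ| ≤ D := by
  have hT : 0 < b - a := sub_pos.2 hab
  rw [potential, integral_Icc_eq_integral_Ioc, ← intervalIntegral.integral_of_le hab.le]
  have := intervalIntegral.norm_integral_le_of_norm_le_const (a := a) (b := b)
    (f := fun t => V (pev γ t)) (C := D / (b - a)) fun t _ => by
      rw [le_div_iff₀ hT]
      exact hV _ (hB t)
  rw [abs_of_pos hT, div_mul_cancel₀ _ hT.ne'] at this
  exact this

lemma continuous_discreteKinetic (τ : ℕ → ℝ) (l : ℕ) :
    Continuous (discreteKinetic τ l : CPath a b n → ℝ) := by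
  refine continuous_finsetSum _ fun j _ => ?_
  exact (((continuous_pev_left _).sub (continuous_pev_left _)).norm.pow 2).div_const _

lemma continuous_discretePotential {V : Eu n → ℝ} (hV : Continuous V) (τ : ℕ → ℝ) (l : ℕ) :
    Continuous (discretePotential V τ l : CPath a b n → ℝ) := by
  refine continuous_finsetSum _ fun j _ => ?_
  have := ((continuous_pev_left (a := a) (b := b) (n := n) (τ (j + 1))).add
    (continuous_pev_left (τ j))).const_smul (2 : ℝ)⁻¹
  exact (hV.comp this).mul_const _

lemma continuous_potential (hab : a ≤ b) {V : Eu n → ℝ} (hV : Continuous V) :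
    Continuous (potential V : CPath a b n → ℝ) := by
  have h1 : Continuous fun γ : CPath a b n => ∫ t in a..b, V (γ (Set.projIcc a b hab t)) := by
    refine intervalIntegral.continuous_parametric_intervalIntegral_of_continuous' ?_ a b
    have h2 : Continuous fun p : CPath a b n × ℝ => p.1 (Set.projIcc a b hab p.2) :=
      continuous_eval.comp (continuous_fst.prodMk ((continuous_projIcc (h := hab)).comp continuous_snd))
    exact hV.comp h2
  refine h1.congr fun γ => ?_
  rw [potential, integral_Icc_eq_integral_Ioc, intervalIntegral.integral_of_le hab]
  refine setIntegral_congr_fun measurableSet_Ioc fun t ht => ?_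
  have ht' := Set.Ioc_subset_Icc_self ht
  simp only [pev_of_mem γ ht', Set.projIcc_of_mem hab ht']

/-- Uniform consistency of the midpoint rule on bounded equicontinuous sets. -/
lemma exists_discretePotential_close (hab : a < b) {V : Eu n → ℝ} (hV : Continuous V) (R : ℝ)
    {ε : ℝ} (hε : 0 < ε) :
    ∃ δ > 0, ∀ (τ : ℕ → ℝ) (l : ℕ) (h : ℝ), IsPartition a b τ l h → ∀ γ γ' : CPath a b n,
      ‖γ‖ ≤ R → ‖γ'‖ ≤ R → dist γ γ' ≤ δ →
      (∀ s t : Set.Icc a b, |(s : ℝ) - t| ≤ h → dist (γ s) (γ t) ≤ δ) →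
      |discretePotential V τ l γ' - potential V γ| ≤ ε := by
  have hT : 0 < b - a := sub_pos.2 hab
  have hu := (isCompact_closedBall (0 : Eu n) R).uniformContinuousOn_of_continuous hV.continuousOn
  obtain ⟨δ, hδ, H⟩ := Metric.uniformContinuousOn_iff.1 hu (ε / (b - a)) (by positivity)
  refine ⟨δ / 3, by positivity, fun τ l h hp γ γ' hγ hγ' hd hosc => ?_⟩
  have hc : ContinuousOn (fun t => V (pev γ t)) (Set.Icc a b) :=
    hV.comp_continuousOn (continuousOn_pev γ)
  have hII : ∀ s ∈ Set.Icc a b, ∀ t ∈ Set.Icc a b,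
      IntervalIntegrable (fun t => V (pev γ t)) volume s t := fun s hs t ht =>
    (hc.mono (Set.uIcc_subset_Icc hs ht)).intervalIntegrable
  have e := intervalIntegral.sum_integral_adjacent_intervals (μ := volume)
    (f := fun t => V (pev γ t)) (a := τ) (n := l)
    fun k hk => hII _ (hp.mem_Icc hk.le) _ (hp.mem_Icc hk)
  rw [hp.2.1, hp.2.2.1] at e
  rw [potential, integral_Icc_eq_integral_Ioc, ← intervalIntegral.integral_of_le hab.le, ← e,
    discretePotential, ← Finset.sum_sub_distrib]
  calc _ ≤ ∑ j ∈ Finset.range l, ε / (b - a) * (τ (j + 1) - τ j) := by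
        refine (Finset.abs_sum_le_sum_abs _ _).trans (Finset.sum_le_sum fun j hj => ?_)
        have hj := Finset.mem_range.1 hj
        have hlt := hp.2.2.2.1 j hj
        have hmesh := hp.2.2.2.2 j hj
        have hjI := hp.mem_Icc hj.le
        have hjI' := hp.mem_Icc (show j + 1 ≤ l from hj)
        set x := (2 : ℝ)⁻¹ • (pev γ' (τ (j + 1)) + pev γ' (τ j)) with hx
        have e1 : V x * (τ (j + 1) - τ j) - ∫ t in τ j..τ (j + 1), V (pev γ t) =
            ∫ t in τ j..τ (j + 1), (V x - V (pev γ t)) := by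
          rw [intervalIntegral.integral_sub (by simp) (hII _ hjI _ hjI'),
            intervalIntegral.integral_const, smul_eq_mul, mul_comm]
        rw [e1, ← Real.norm_eq_abs]
        conv_rhs => rw [← abs_of_pos (sub_pos.2 hlt)]
        refine intervalIntegral.norm_integral_le_of_norm_le_const fun t ht => ?_
        rw [Set.uIoc_of_le hlt.le] at ht
        have htI : t ∈ Set.Icc a b := ⟨hjI.1.trans ht.1.le, ht.2.trans hjI'.2⟩
        have near : ∀ (s : ℝ) (hs : s ∈ Set.Icc a b), |s - t| ≤ h →
            pev γ' s ∈ Metric.closedBall (pev γ t) (δ / 3 + δ / 3) := by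
          intro s hs hst
          have d1 := dist_pev_le γ γ' s
          have d2 := hosc ⟨s, hs⟩ ⟨t, htI⟩ hst
          rw [← pev_of_mem γ hs, ← pev_of_mem γ htI] at d2
          rw [Metric.mem_closedBall]
          refine (dist_triangle _ (pev γ s) _).trans (add_le_add ?_ d2)
          rw [dist_comm]
          exact d1.trans hd
        have n1 := near (τ j) hjI (by rw [abs_le]; constructor <;> linarith [ht.1, ht.2])
        have n2 := near (τ (j + 1)) hjI' (by rw [abs_le]; constructor <;> linarith [ht.1, ht.2])
        have hmid := (convex_closedBall (pev γ t) (δ / 3 + δ / 3)) n2 n1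
          (show (0 : ℝ) ≤ 2⁻¹ by norm_num) (show (0 : ℝ) ≤ 2⁻¹ by norm_num) (by norm_num)
        rw [← smul_add, ← hx, Metric.mem_closedBall] at hmid
        have hxR : x ∈ Metric.closedBall (0 : Eu n) R := by
          have m1 : pev γ' (τ j) ∈ Metric.closedBall (0 : Eu n) R := by
            simpa using (norm_pev_le γ' _).trans hγ'
          have m2 : pev γ' (τ (j + 1)) ∈ Metric.closedBall (0 : Eu n) R := by
            simpa using (norm_pev_le γ' _).trans hγ'
          have := (convex_closedBall (0 : Eu n) R) m2 m1
            (show (0 : ℝ) ≤ 2⁻¹ by norm_num) (show (0 : ℝ) ≤ 2⁻¹ by norm_num) (by norm_num)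
          rwa [← smul_add, ← hx] at this
        have := H x hxR (pev γ t) (by simpa using (norm_pev_le γ t).trans hγ) (by linarith)
        rw [Real.dist_eq] at this
        exact this.le
    _ = ε := by
        rw [← Finset.mul_sum, hp.sum_sub]
        field_simp

end Potential

section SignedIntegral

variable {X : Type*} [MeasurableSpace X]

lemma epos_sub_coe (x : ℝ≥0∞) (C : ℝ≥0) :
    epos ((x : EReal) - ((C : ℝ) : EReal)) = x - C := by
  induction x with
  | top => simp [epos]
  | coe x =>
    have h : (((x : ℝ≥0∞) : EReal) - ((C : ℝ) : EReal)) = (((x : ℝ) - C : ℝ) : EReal) := by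
      rw [EReal.coe_sub]; rfl
    rw [h, epos, if_neg (EReal.coe_ne_top _), EReal.toReal_coe, ENNReal.ofReal_sub _ C.coe_nonneg]
    simp

lemma epos_neg_sub_coe (x : ℝ≥0∞) (C : ℝ≥0) :
    epos (-((x : EReal) - ((C : ℝ) : EReal))) = C - x := by
  induction x with
  | top => simp [epos]
  | coe x =>
    have h : -(((x : ℝ≥0∞) : EReal) - ((C : ℝ) : EReal)) = (((C : ℝ) - x : ℝ) : EReal) := by
      rw [← neg_sub, EReal.coe_neg, EReal.coe_sub]; rfl
    rw [h, epos, if_neg (EReal.coe_ne_top _), EReal.toReal_coe, ENNReal.ofReal_sub _ x.coe_nonneg]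
    simp

lemma EReal.coe_ennreal_sub_coe_eq_of_add_eq {A B I : ℝ≥0∞} {C : ℝ≥0} (hB : B ≠ ⊤)
    (h : A + C = B + I) : (A : EReal) - (B : EReal) = (I : EReal) - ((C : ℝ) : EReal) := by
  lift B to ℝ≥0 using hB
  induction I with
  | top =>
    have hA : A = ⊤ := by simpa using h
    simp [hA]
  | coe I =>
    have hA : A ≠ ⊤ := by
      rintro rfl
      simp at h
      exact absurd h.symm (by simp [← ENNReal.coe_add])
    lift A to ℝ≥0 using hA
    norm_cast at h
    have h' : (A : ℝ) + C = B + I := by exact_mod_cast h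
    have e : (A : ℝ) - B = I - C := by linarith
    calc _ = (((A : ℝ) - B : ℝ) : EReal) := by rw [EReal.coe_sub]; rfl
      _ = _ := by rw [e, EReal.coe_sub]; rfl

/-- The integral of a function bounded below by `-C` is the integral of its shift minus `C`. -/
lemma mint_eq_lintegral_sub {π : Measure X} [IsProbabilityMeasure π] {F : X → EReal}
    {H : X → ℝ≥0∞} (hH : AEMeasurable H π) (C : ℝ≥0)
    (hF : ∀ᵐ γ ∂π, F γ = (H γ : EReal) - ((C : ℝ) : EReal)) :
    mint F π = ((∫⁻ γ, H γ ∂π : ℝ≥0∞) : EReal) - ((C : ℝ) : EReal) := by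
  have h1 : ∫⁻ γ, epos (F γ) ∂π = ∫⁻ γ, (H γ - C) ∂π := by
    refine lintegral_congr_ae ?_
    filter_upwards [hF] with γ h
    rw [h, epos_sub_coe]
  have h2 : ∫⁻ γ, epos (-(F γ)) ∂π = ∫⁻ γ, (C - H γ) ∂π := by
    refine lintegral_congr_ae ?_
    filter_upwards [hF] with γ h
    rw [h, epos_neg_sub_coe]
  have hC : ∫⁻ _ : X, (C : ℝ≥0∞) ∂π = C := by simp
  rw [mint, h1, h2]
  refine EReal.coe_ennreal_sub_coe_eq_of_add_eq ?_ ?_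
  · refine ne_top_of_le_ne_top (ENNReal.coe_ne_top (r := C)) ?_
    exact (lintegral_mono fun γ => tsub_le_self).trans hC.le
  · calc (∫⁻ γ, (H γ - C) ∂π) + C = ∫⁻ γ, (H γ - C + C) ∂π := by
          rw [lintegral_add_right _ measurable_const, hC]
      _ = ∫⁻ γ, (C - H γ + H γ) ∂π := by simp_rw [tsub_add_eq_max, max_comm]
      _ = _ := lintegral_add_right' _ hH

end SignedIntegral

section LowerBounds

variable {a b : ℝ} {n : ℕ}

/-- Curves starting in the ball of radius `R` have potential at most half their kinetic energy
plus `C`. -/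
def PotentialBound (a b m : ℝ) (V : Eu n → ℝ) (R : ℝ) (C : ℝ≥0) : Prop :=
  ∀ (x : Eu n) (E : ℝ), 0 ≤ E → ‖x‖ ^ 2 ≤ 2 * R ^ 2 + 2 * (b - a) * E →
    |V x| * (b - a) ≤ m / 4 * E + C

lemma PotentialBound.le_dActionSum {m : ℝ} {V : Eu n → ℝ} {R : ℝ} {C : ℝ≥0}
    (hC : PotentialBound a b m V R C) (hab : a < b) {τ : ℕ → ℝ} {l : ℕ} {δ : ℝ}
    (hp : IsPartition a b τ l δ) {γ : CPath a b n} (hγ : PiecewiseAffine a b τ l γ)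
    (hR : ‖pev γ a‖ ≤ R) : m / 4 * discreteKinetic τ l γ ≤ dActionSum m V τ l γ + C := by
  obtain ⟨g, hg, hE⟩ := hγ.exists_isL2Deriv hp
  have h1 := abs_discretePotential_le V hp hab (hg.norm_pev_sq_le hab hR)
    fun x hx => hC x _ (integral_nonneg fun u => by positivity) hx
  rw [hE] at h1
  rw [dActionSum_eq]
  linarith [(abs_le.1 h1).2]

lemma PotentialBound.le_potential {m : ℝ} {V : Eu n → ℝ} {R : ℝ} {C : ℝ≥0}
    (hC : PotentialBound a b m V R C) (hab : a < b) {γ : CPath a b n} {g : ℝ → Eu n}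
    (hg : IsL2Deriv γ g) (hR : ‖pev γ a‖ ≤ R) :
    m / 4 * (∫ u in Set.Icc a b, ‖g u‖ ^ 2) ≤
      m / 2 * (∫ u in Set.Icc a b, ‖g u‖ ^ 2) - potential V γ + C := by
  have h1 := abs_potential_le V hab (hg.norm_pev_sq_le hab hR)
    fun x hx => hC x _ (integral_nonneg fun u => by positivity) hx
  linarith [(abs_le.1 h1).2]

/-- The action shifted by `C`, as a pointwise limit of discrete functionals. -/
noncomputable def shiftedAction (m : ℝ) (V : Eu n → ℝ) (C : ℝ≥0) (γ : CPath a b n) : ℝ≥0∞ :=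
  liminf (fun j => ENNReal.ofReal (m / 2 * gridKinetic γ j - potential V γ + C)) atTop

lemma continuous_gridKinetic (j : ℕ) : Continuous fun γ : CPath a b n => gridKinetic γ j :=
  continuous_discreteKinetic _ _

lemma measurable_shiftedAction (hab : a ≤ b) (m : ℝ) {V : Eu n → ℝ} (hV : Continuous V)
    (C : ℝ≥0) : Measurable (shiftedAction m V C : CPath a b n → ℝ≥0∞) := by
  refine Measurable.liminf fun j => ?_
  refine (Continuous.measurable ?_).ennreal_ofReal
  exact ((continuous_const.mul (continuous_gridKinetic j)).sub
    (continuous_potential hab hV)).add continuous_const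

lemma IsL2Deriv.shiftedAction_eq (hab : a < b) {m : ℝ} (V : Eu n → ℝ) (C : ℝ≥0)
    {γ : CPath a b n} {g : ℝ → Eu n} (hg : IsL2Deriv γ g) :
    shiftedAction m V C γ =
      ENNReal.ofReal (m / 2 * (∫ u in Set.Icc a b, ‖g u‖ ^ 2) - potential V γ + C) :=
  Tendsto.liminf_eq <| ENNReal.tendsto_ofReal <|
    (((hg.tendsto_gridKinetic hab).const_mul _).sub_const _).add_const _

lemma shiftedAction_eq_top (hab : a < b) {m : ℝ} (hm : 0 < m) (V : Eu n → ℝ) (C : ℝ≥0)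
    {γ : CPath a b n} (hγ : ¬ ∃ g, IsL2Deriv γ g) : shiftedAction m V C γ = ⊤ :=
  Tendsto.liminf_eq <| ENNReal.tendsto_ofReal_nhds_top.2 <|
    tendsto_atTop_add_const_right _ _ <| tendsto_atTop_add_const_right _ _ <|
      (tendsto_gridKinetic_atTop hab hγ).const_mul_atTop (by positivity)

lemma PotentialBound.action_eq {m : ℝ} (hm : 0 < m) {V : Eu n → ℝ} (hV : Continuous V)
    {L : Eu n → Eu n → ℝ} (hL : ∀ x v : Eu n, L x v = m / 2 * ‖v‖ ^ 2 - V x) {R : ℝ} {C : ℝ≥0}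
    (hC : PotentialBound a b m V R C) (hab : a < b) {γ : CPath a b n} (hR : ‖pev γ a‖ ≤ R) :
    action L a b γ = (shiftedAction m V C γ : EReal) - ((C : ℝ) : EReal) := by
  by_cases hγ : ∃ g, IsL2Deriv γ g
  · obtain ⟨g, hg⟩ := hγ
    have h0 := hC.le_potential hab hg hR
    have hE : 0 ≤ m / 4 * ∫ u in Set.Icc a b, ‖g u‖ ^ 2 :=
      mul_nonneg (by positivity) (integral_nonneg fun u => by positivity)
    rw [hg.action_eq hV hL, hg.shiftedAction_eq hab V C, EReal.coe_ennreal_ofReal,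
      max_eq_left (hE.trans h0), ← EReal.coe_sub, add_sub_cancel_right]
  · rw [action_eq_top hm hV hL hγ, shiftedAction_eq_top hab hm V C hγ]
    simp

open Classical in
/-- The discrete action shifted by `C`. -/
noncomputable def shiftedDAction (m : ℝ) (V : Eu n → ℝ) (τ : ℕ → ℝ) (l : ℕ) (C : ℝ≥0)
    (γ : CPath a b n) : ℝ≥0∞ :=
  if PiecewiseAffine a b τ l γ then ENNReal.ofReal (dActionSum m V τ l γ + C) else ⊤

lemma isClosed_piecewiseAffine (τ : ℕ → ℝ) (l : ℕ) :
    IsClosed {γ : CPath a b n | PiecewiseAffine a b τ l γ} := by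
  simp only [PiecewiseAffine, Set.ofPred_forall]
  refine isClosed_iInter fun j => isClosed_iInter fun _ => isClosed_iInter fun t =>
    isClosed_iInter fun _ => ?_
  refine isClosed_eq (continuous_eval_const _) ((continuous_pev_left _).add ?_)
  have := (continuous_pev_left (a := a) (b := b) (n := n) (τ (j + 1))).sub
    (continuous_pev_left (τ j))
  exact this.const_smul (((t : ℝ) - τ j) / (τ (j + 1) - τ j))

lemma continuous_dActionSum (m : ℝ) {V : Eu n → ℝ} (hV : Continuous V) (τ : ℕ → ℝ) (l : ℕ) :
    Continuous (dActionSum m V τ l : CPath a b n → ℝ) := by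
  have : (dActionSum m V τ l : CPath a b n → ℝ) =
      fun γ => m / 2 * discreteKinetic τ l γ - discretePotential V τ l γ :=
    funext (dActionSum_eq m V τ l)
  rw [this]
  exact (continuous_const.mul (continuous_discreteKinetic τ l)).sub
    (continuous_discretePotential hV τ l)

lemma measurable_shiftedDAction (m : ℝ) {V : Eu n → ℝ} (hV : Continuous V) (τ : ℕ → ℝ) (l : ℕ)
    (C : ℝ≥0) : Measurable (shiftedDAction m V τ l C : CPath a b n → ℝ≥0∞) := by
  classical
  refine Measurable.ite (isClosed_piecewiseAffine τ l).measurableSet ?_ measurable_const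
  exact ((continuous_dActionSum m hV τ l).add continuous_const).measurable.ennreal_ofReal

lemma PotentialBound.dAction_eq {m : ℝ} (hm : 0 < m) {V : Eu n → ℝ} {R : ℝ} {C : ℝ≥0}
    (hC : PotentialBound a b m V R C) (hab : a < b) {τ : ℕ → ℝ} {l : ℕ} {δ : ℝ}
    (hp : IsPartition a b τ l δ) {γ : CPath a b n} (hR : ‖pev γ a‖ ≤ R) :
    dAction m V a b τ l γ = (shiftedDAction m V τ l C γ : EReal) - ((C : ℝ) : EReal) := by
  rw [dAction, shiftedDAction]
  split_ifs with hγ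
  · have h0 := hC.le_dActionSum hab hp hγ hR
    have hE : 0 ≤ m / 4 * discreteKinetic τ l γ :=
      mul_nonneg (by positivity) (discreteKinetic_nonneg hp γ)
    rw [EReal.coe_ennreal_ofReal, max_eq_left (hE.trans h0), ← EReal.coe_sub,
      add_sub_cancel_right]
  · simp

end LowerBounds

section LowerSemicontinuity

variable {a b : ℝ} {n : ℕ}

lemma EReal.coe_ennreal_sub_lt_iff {I : ℝ≥0∞} {C : ℝ≥0} {c : ℝ} :
    (I : EReal) - ((C : ℝ) : EReal) < c ↔ I < ENNReal.ofReal (c + C) := by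
  induction I with
  | top => simp
  | coe x =>
    have h : (((x : ℝ≥0∞) : EReal) - ((C : ℝ) : EReal)) = (((x : ℝ) - C : ℝ) : EReal) := by
      rw [EReal.coe_sub]; rfl
    rw [h, EReal.coe_lt_coe_iff, ENNReal.lt_ofReal_iff_toReal_lt ENNReal.coe_ne_top,
      ENNReal.coe_toReal, sub_lt_iff_lt_add]

lemma liminf_le_liminf_min_natCast (u : ℕ → ℝ≥0∞) :
    liminf u atTop ≤ liminf (fun j => min (u j) j) atTop := by
  refine le_of_forall_lt fun c hc => ?_
  obtain ⟨d, hcd, hd⟩ := exists_between hc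
  refine hcd.trans_le (le_liminf_of_le (by isBoundedDefault) ?_)
  obtain ⟨k, hk⟩ := ENNReal.exists_nat_gt hd.ne_top
  filter_upwards [eventually_lt_of_lt_liminf hd, eventually_ge_atTop k] with j h1 h2
  exact le_min h1.le (hk.le.trans (by exact_mod_cast h2))

lemma WeakLim.tendsto_lintegral_ofReal {X : Type*} [TopologicalSpace X] [MeasurableSpace X]
    [OpensMeasurableSpace X] {πs : ℕ → Measure X} {π : Measure X}
    [∀ k, IsProbabilityMeasure (πs k)] [IsProbabilityMeasure π] (hπ : WeakLim πs π)
    {G : X → ℝ} (hG : Continuous G) (h0 : ∀ x, 0 ≤ G x) {B : ℝ} (hB : ∀ x, G x ≤ B) :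
    Tendsto (fun k => ∫⁻ x, ENNReal.ofReal (G x) ∂(πs k)) atTop
      (𝓝 (∫⁻ x, ENNReal.ofReal (G x) ∂π)) := by
  let φ : BoundedContinuousFunction X ℝ := BoundedContinuousFunction.ofNormedAddCommGroup G hG B
    fun x => by rw [Real.norm_of_nonneg (h0 x)]; exact hB x
  have key : ∀ (μ : Measure X) [IsProbabilityMeasure μ],
      ∫⁻ x, ENNReal.ofReal (G x) ∂μ = ENNReal.ofReal (∫ x, φ x ∂μ) := fun μ _ =>
    (ofReal_integral_eq_lintegral_ofReal (φ.integrable μ) (Eventually.of_forall h0)).symm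
  simp_rw [key]
  exact ENNReal.tendsto_ofReal (hπ φ)

/-- Piecewise affine curves on fine partitions have discrete action above any truncation of the
action evaluated on a fixed grid. -/
lemma PotentialBound.eventually_le_shiftedDAction {m : ℝ} (hm : 0 < m) {V : Eu n → ℝ}
    (hV : Continuous V) {R : ℝ} {C : ℝ≥0} (hC : PotentialBound a b m V R C) (hab : a < b)
    {h : ℕ → ℝ} (hto0 : Tendsto h atTop (𝓝 0)) {l : ℕ → ℕ} {τ : ℕ → ℕ → ℝ}
    (hpart : ∀ N, IsPartition a b (τ N) (l N) (h N)) (j : ℕ) {ε : ℝ} (hε : 0 < ε) :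
    ∀ᶠ N in atTop, ∀ γ : CPath a b n, ‖pev γ a‖ ≤ R →
      ENNReal.ofReal (max 0 (min (m / 2 * gridKinetic γ j - potential V γ + C) j)) ≤
        shiftedDAction m V (τ N) (l N) C γ + ENNReal.ofReal ε := by
  have hT : 0 < b - a := sub_pos.2 hab
  set Λ : ℝ := 4 * j / m with hΛ
  have hΛ0 : 0 ≤ Λ := by positivity
  set R' := Real.sqrt (2 * R ^ 2 + 2 * (b - a) * Λ) with hR'
  obtain ⟨δ, hδ, H⟩ := exists_discretePotential_close (n := n) hab hV R' hε
  have hev : ∀ᶠ N in atTop, h N * Λ < δ ^ 2 := by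
    have := hto0.mul_const Λ
    rw [zero_mul] at this
    exact this.eventually_lt_const (by positivity)
  filter_upwards [hev] with N hN γ hR
  have hp := hpart N
  by_cases hγ : PiecewiseAffine a b (τ N) (l N) γ
  swap
  · simp [shiftedDAction, hγ]
  rw [shiftedDAction, if_pos hγ]
  have hlow := hC.le_dActionSum hab hp hγ hR
  obtain ⟨g, hg, hE⟩ := hγ.exists_isL2Deriv hp
  have hE0 : 0 ≤ m / 4 * discreteKinetic (τ N) (l N) γ :=
    mul_nonneg (by positivity) (discreteKinetic_nonneg hp γ)
  rw [← ENNReal.ofReal_add (hE0.trans hlow) hε.le]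
  refine ENNReal.ofReal_le_ofReal (max_le (by linarith) ?_)
  rcases le_or_gt (discreteKinetic (τ N) (l N) γ) Λ with hle | hgt
  · refine (min_le_left _ _).trans ?_
    have hgrid : gridKinetic γ j ≤ discreteKinetic (τ N) (l N) γ := by
      rw [← hE]
      exact hg.discreteKinetic_le (isPartition_uniformGrid hab j)
    have hnorm : ‖γ‖ ≤ R' := by
      refine (ContinuousMap.norm_le _ (Real.sqrt_nonneg _)).2 fun t => Real.le_sqrt_of_sq_le ?_
      have := hg.norm_pev_sq_le hab hR t
      rw [pev_of_mem γ t.2, hE] at this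
      refine this.trans ?_
      gcongr
    have hosc : ∀ s t : Set.Icc a b, |(s : ℝ) - t| ≤ h N → dist (γ s) (γ t) ≤ δ := by
      intro s t hst
      have := hg.norm_sub_sq_le_energy t.2 s.2
      rw [pev_of_mem γ t.2, pev_of_mem γ s.2, hE, ← dist_eq_norm] at this
      refine (abs_le_of_sq_le_sq' (this.trans ?_) hδ.le).2
      refine (mul_le_mul hst hle (discreteKinetic_nonneg hp γ) ?_).trans hN.le
      exact (abs_nonneg _).trans hst
    have := abs_le.1 (H _ _ _ hp γ γ hnorm hnorm (by simpa using hδ.le) hosc)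
    rw [dActionSum_eq]
    have : m / 2 * gridKinetic γ j ≤ m / 2 * discreteKinetic (τ N) (l N) γ := by gcongr
    linarith
  · refine (min_le_right _ _).trans ?_
    have : m / 4 * Λ ≤ m / 4 * discreteKinetic (τ N) (l N) γ := by gcongr
    have e : m / 4 * Λ = j := by rw [hΛ]; field_simp
    linarith

lemma PotentialBound.lintegral_shiftedAction_le_liminf {m : ℝ} (hm : 0 < m) {V : Eu n → ℝ}
    (hV : Continuous V) {R : ℝ} {C : ℝ≥0} (hC : PotentialBound a b m V R C) (hab : a < b)
    {h : ℕ → ℝ} (hto0 : Tendsto h atTop (𝓝 0)) {l : ℕ → ℕ} {τ : ℕ → ℕ → ℝ}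
    (hpart : ∀ N, IsPartition a b (τ N) (l N) (h N)) {πs : ℕ → Measure (CPath a b n)}
    {π : Measure (CPath a b n)} [∀ N, IsProbabilityMeasure (πs N)] [IsProbabilityMeasure π]
    (hπ : WeakLim πs π) (hR : ∀ N, ∀ᵐ γ ∂(πs N), ‖pev γ a‖ ≤ R) :
    ∫⁻ γ, shiftedAction m V C γ ∂π ≤
      liminf (fun N => ∫⁻ γ, shiftedDAction m V (τ N) (l N) C γ ∂(πs N)) atTop := by
  set G : ℕ → CPath a b n → ℝ := fun j γ =>
    max 0 (min (m / 2 * gridKinetic γ j - potential V γ + C) j) with hG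
  have hGc : ∀ j, Continuous (G j) := fun j =>
    continuous_const.max ((((continuous_const.mul (continuous_gridKinetic j)).sub
      (continuous_potential hab.le hV)).add continuous_const).min continuous_const)
  have hGeq : ∀ j γ, ENNReal.ofReal (G j γ) =
      min (ENNReal.ofReal (m / 2 * gridKinetic γ j - potential V γ + C)) j := by
    intro j γ
    rw [hG]
    simp only
    rw [ENNReal.ofReal_max, ENNReal.ofReal_min]
    simp
  have hstep : ∀ j, ∫⁻ γ, ENNReal.ofReal (G j γ) ∂π ≤
      liminf (fun N => ∫⁻ γ, shiftedDAction m V (τ N) (l N) C γ ∂(πs N)) atTop := by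
    intro j
    have ht := hπ.tendsto_lintegral_ofReal (hGc j) (fun γ => le_max_left _ _) (B := j)
      fun γ => max_le (by positivity) (min_le_right _ _)
    refine le_of_forall_lt fun c hc => ?_
    obtain ⟨d, hcd, hd⟩ := exists_between hc
    obtain ⟨ε, hε, hεd⟩ : ∃ ε : ℝ, 0 < ε ∧
        d + ENNReal.ofReal ε < ∫⁻ γ, ENNReal.ofReal (G j γ) ∂π := by
      obtain ⟨r, hr, h'⟩ := ENNReal.lt_iff_exists_add_pos_lt.1 hd
      exact ⟨r, hr, by simpa using h'⟩
    refine hcd.trans_le (le_liminf_of_le (by isBoundedDefault) ?_)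
    filter_upwards [ht.eventually_const_lt hεd,
      hC.eventually_le_shiftedDAction hm hV hab hto0 hpart j hε] with N h1 h2
    have h3 : ∫⁻ γ, ENNReal.ofReal (G j γ) ∂(πs N) ≤
        ∫⁻ γ, shiftedDAction m V (τ N) (l N) C γ ∂(πs N) + ENNReal.ofReal ε := by
      calc _ ≤ ∫⁻ γ, (shiftedDAction m V (τ N) (l N) C γ + ENNReal.ofReal ε) ∂(πs N) := by
            refine lintegral_mono_ae ?_
            filter_upwards [hR N] with γ hγ using h2 γ hγ
        _ = _ := by
            rw [lintegral_add_right _ measurable_const]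
            simp
    exact ((ENNReal.add_lt_add_iff_right ENNReal.ofReal_ne_top).1 (h1.trans_le h3)).le
  calc ∫⁻ γ, shiftedAction m V C γ ∂π
      ≤ ∫⁻ γ, liminf (fun j => ENNReal.ofReal (G j γ)) atTop ∂π := by
        refine lintegral_mono fun γ => ?_
        simp_rw [hGeq]
        exact liminf_le_liminf_min_natCast _
    _ ≤ liminf (fun j => ∫⁻ γ, ENNReal.ofReal (G j γ) ∂π) atTop :=
        lintegral_liminf_le fun j => (hGc j).measurable.ennreal_ofReal
    _ ≤ liminf (fun _ : ℕ => liminf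
          (fun N => ∫⁻ γ, shiftedDAction m V (τ N) (l N) C γ ∂(πs N)) atTop) atTop :=
        liminf_le_liminf (Eventually.of_forall hstep)
    _ = _ := liminf_const _

lemma WeakLim.map_eq {X Y : Type*} [TopologicalSpace X] [MeasurableSpace X]
    [OpensMeasurableSpace X] [TopologicalSpace Y] [MeasurableSpace Y] [BorelSpace Y]
    [HasOuterApproxClosed Y]
    {πs : ℕ → Measure X} {π : Measure X} {μs : ℕ → Measure Y} {μ : Measure Y}
    [IsFiniteMeasure π] [IsFiniteMeasure μ] (hπ : WeakLim πs π) (hμ : WeakLim μs μ)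
    {f : X → Y} (hf : Continuous f) (hmap : ∀ k, (πs k).map f = μs k) : π.map f = μ := by
  refine ext_of_forall_integral_eq_of_IsFiniteMeasure fun φ => ?_
  have h1 := hπ (φ.compContinuous ⟨f, hf⟩)
  have key : ∀ ν : Measure X, ∫ x, φ x ∂(ν.map f) = ∫ x, (φ.compContinuous ⟨f, hf⟩) x ∂ν :=
    fun ν => integral_map hf.measurable.aemeasurable φ.continuous.aestronglyMeasurable
  simp_rw [← key, hmap] at h1
  exact tendsto_nhds_unique h1 (hμ φ)

lemma WeakLim.comp {X : Type*} [TopologicalSpace X] [MeasurableSpace X] {πs : ℕ → Measure X}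
    {π : Measure X} (hπ : WeakLim πs π) {φ : ℕ → ℕ} (hφ : Tendsto φ atTop atTop) :
    WeakLim (πs ∘ φ) π := fun f => (hπ f).comp hφ

lemma emp_compl_eq_zero {X : Type*} [MeasurableSpace X] {N : ℕ} {x : Fin N → X} {K : Set X}
    (hK : MeasurableSet K) (hx : ∀ i, x i ∈ K) : emp N x Kᶜ = 0 := by
  simp only [emp, Measure.smul_apply, Measure.coe_finsetSum, Finset.sum_apply, smul_eq_mul]
  rw [Finset.sum_eq_zero, mul_zero]
  intro i _
  rw [Measure.dirac_apply' _ hK.compl]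
  simp [hx i]

/-- The liminf inequality. -/
lemma aFun_le_liminf (hab : a < b)
    {m : ℝ} (hm : 0 < m) {V : Eu n → ℝ} (hV : Continuous V) {R : ℝ} {C : ℝ≥0}
    (hC : PotentialBound a b m V R C)
    {L : Eu n → Eu n → ℝ} (hL : ∀ x v : Eu n, L x v = m / 2 * ‖v‖ ^ 2 - V x)
    {h : ℕ → ℝ} (hto0 : Tendsto h atTop (𝓝 0)) {l : ℕ → ℕ} {τ : ℕ → ℕ → ℝ}
    (hpart : ∀ N, IsPartition a b (τ N) (l N) (h N))
    {μa μb : Measure (Eu n)} [IsProbabilityMeasure μa] [IsProbabilityMeasure μb]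
    (hμa : ∀ᵐ z ∂μa, ‖z‖ ≤ R) {νa νb : ℕ → Measure (Eu n)}
    (hνa : ∀ N, ∀ᵐ z ∂(νa N), ‖z‖ ≤ R) (hxw : WeakLim νa μa) (hyw : WeakLim νb μb)
    {πs : ℕ → Measure (CPath a b n)} {π : Measure (CPath a b n)}
    [∀ N, IsProbabilityMeasure (πs N)] [IsProbabilityMeasure π] (hπ : WeakLim πs π) :
    aFun (action L a b) μa μb π ≤
      liminf (fun N => aFun (dAction m V a b (τ N) (l N)) (νa N) (νb N) (πs N)) atTop := by
  by_contra! hlt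
  obtain ⟨c, hc1, hc2⟩ := EReal.lt_iff_exists_real_btwn.1 hlt
  obtain ⟨φ, hφ, hφc⟩ := extraction_of_frequently_atTop
    (frequently_lt_of_liminf_lt (by isBoundedDefault) hc1)
  have hmarg : ∀ k, Measure.map (fun γ => pev γ a) (πs (φ k)) = νa (φ k) ∧
      Measure.map (fun γ => pev γ b) (πs (φ k)) = νb (φ k) := by
    intro k
    by_contra hcon
    have := hφc k
    rw [aFun, if_neg hcon] at this
    exact not_top_lt this
  have hφt := hφ.tendsto_atTop
  have hπφ := hπ.comp hφt
  have ma : π.map (fun γ => pev γ a) = μa :=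
    hπφ.map_eq (hxw.comp hφt) (continuous_pev_left a) fun k => (hmarg k).1
  have mb : π.map (fun γ => pev γ b) = μb :=
    hπφ.map_eq (hyw.comp hφt) (continuous_pev_left b) fun k => (hmarg k).2
  have hball : MeasurableSet {z : Eu n | ‖z‖ ≤ R} := measurableSet_le (by fun_prop) (by fun_prop)
  have hRπ : ∀ᵐ γ ∂π, ‖pev γ a‖ ≤ R := by
    rw [← ma] at hμa
    exact (ae_map_iff (continuous_pev_left a).measurable.aemeasurable hball).1 hμa
  have hRk : ∀ k, ∀ᵐ γ ∂(πs (φ k)), ‖pev γ a‖ ≤ R := by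
    intro k
    have := hνa (φ k)
    rw [← (hmarg k).1] at this
    exact (ae_map_iff (continuous_pev_left a).measurable.aemeasurable hball).1 this
  have hIk : ∀ k, ∫⁻ γ, shiftedDAction m V (τ (φ k)) (l (φ k)) C γ ∂(πs (φ k)) <
      ENNReal.ofReal (c + C) := by
    intro k
    have h1 := hφc k
    rw [aFun, if_pos (hmarg k), mint_eq_lintegral_sub
      (measurable_shiftedDAction m hV _ _ C).aemeasurable C
      ((hRk k).mono fun γ hγ => hC.dAction_eq hm hab (hpart _) hγ)] at h1
    exact EReal.coe_ennreal_sub_lt_iff.1 h1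
  rw [aFun, if_pos ⟨ma, mb⟩, mint_eq_lintegral_sub
    (measurable_shiftedAction hab.le m hV C).aemeasurable C
    (hRπ.mono fun γ hγ => hC.action_eq hm hV hL hab hγ)] at hc2
  obtain ⟨c', hcc', hc'⟩ := EReal.lt_iff_exists_real_btwn.1 hc2
  rw [EReal.coe_lt_coe_iff] at hcc'
  refine hc'.not_gt (EReal.coe_ennreal_sub_lt_iff.2 ?_)
  have hIpos : 0 < c + (C : ℝ) := ENNReal.ofReal_pos.1 (bot_le.trans_lt (hIk 0))
  calc ∫⁻ γ, shiftedAction m V C γ ∂π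
      ≤ liminf (fun k => ∫⁻ γ, shiftedDAction m V (τ (φ k)) (l (φ k)) C γ ∂(πs (φ k))) atTop :=
        hC.lintegral_shiftedAction_le_liminf hm hV hab (hto0.comp hφt) (fun k => hpart (φ k)) hπφ
          hRk
    _ ≤ ENNReal.ofReal (c + C) := by
        refine (liminf_le_liminf (Eventually.of_forall fun k => (hIk k).le)).trans ?_
        exact (liminf_const _).le
    _ < ENNReal.ofReal (c' + C) := (ENNReal.ofReal_lt_ofReal_iff (by linarith)).2 (by linarith)

end LowerSemicontinuity

section Coupling

open ProbabilityTheory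

variable {E : Type*} [MetricSpace E] [MeasurableSpace E]

lemma measure_frontier_disjointed_eq_zero (μ : Measure E) {B : ℕ → Set E}
    (hB : ∀ i, μ (frontier (B i)) = 0) (i : ℕ) : μ (frontier (disjointed B i)) = 0 := by
  have hdiff : ∀ s t : Set E, μ (frontier s) = 0 → μ (frontier t) = 0 →
      μ (frontier (s \ t)) = 0 := by
    intro s t hs ht
    rw [Set.sdiff_eq]
    refine measure_mono_null (frontier_inter_subset s tᶜ) (measure_union_null ?_ ?_)
    · exact measure_mono_null Set.inter_subset_left hs
    · rw [frontier_compl]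
      exact measure_mono_null Set.inter_subset_right ht
  exact disjointedRec (p := fun s => μ (frontier s) = 0) (fun s j hs => hdiff _ _ hs (hB j)) (hB i)

variable [BorelSpace E]

/-- Measurable partition of the space into finitely many small continuity sets (and null sets). -/
lemma exists_small_partition (μ : Measure E) [IsFiniteMeasure μ] {K : Set E} (hK : IsCompact K)
    (hμK : ∀ᵐ x ∂μ, x ∈ K) {ε : ℝ} (hε : 0 < ε) :
    ∃ (q : E → ℕ) (M : ℕ), Measurable q ∧ (∀ i, μ (frontier (q ⁻¹' {i})) = 0) ∧
      (∀ᵐ x ∂μ, q x < M) ∧ ∀ x y, q x = q y → q x < M → dist x y ≤ ε := by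
  have hr : ∀ x : E, ∃ r ∈ Set.Ioo 0 (ε / 2), μ (frontier (Metric.ball x r)) = 0 := by
    intro x
    obtain ⟨r, hr, h⟩ := exists_null_frontier_thickening μ {x} (half_pos hε)
    exact ⟨r, hr, by rwa [Metric.thickening_singleton] at h⟩
  choose r hr hrμ using hr
  obtain ⟨t, -, ht⟩ := hK.elim_nhds_subcover (fun x => Metric.ball x (r x))
    fun x _ => Metric.ball_mem_nhds x (hr x).1
  set L := t.toList with hL
  set B : ℕ → Set E := fun i => if hi : i < L.length then Metric.ball L[i] (r L[i]) else Set.univ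
    with hBdef
  have hex : ∀ x, ∃ i, x ∈ B i := fun x => ⟨L.length, by simp [hBdef]⟩
  classical
  have hBm : ∀ i, MeasurableSet (B i) := by
    intro i
    simp only [hBdef]
    split_ifs
    · exact measurableSet_ball
    · exact MeasurableSet.univ
  have hBf : ∀ i, μ (frontier (B i)) = 0 := by
    intro i
    simp only [hBdef]
    split_ifs
    · exact hrμ _
    · simp
  refine ⟨fun x => Nat.find (hex x), L.length, measurable_find hex hBm, fun i => ?_, ?_, ?_⟩
  · rw [preimage_find_eq_disjointed B hex]
    exact measure_frontier_disjointed_eq_zero μ hBf i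
  · filter_upwards [hμK] with x hx
    obtain ⟨c, hc, hxc⟩ := Set.mem_iUnion₂.1 (ht hx)
    obtain ⟨i, hi, hic⟩ := List.getElem_of_mem (Finset.mem_toList.2 hc)
    refine lt_of_le_of_lt (Nat.find_min' (hex x) ?_) hi
    simp only [hBdef]
    rw [dif_pos hi, hic]
    exact hxc
  · intro x y hxy hlt
    have hx := Nat.find_spec (hex x)
    have hy := Nat.find_spec (hex y)
    simp only at hxy hlt
    rw [← hxy] at hy
    simp only [hBdef] at hx hy
    rw [dif_pos hlt] at hx hy
    have h1 := (hr L[Nat.find (hex x)]).2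
    have h2 := dist_triangle_right x y L[Nat.find (hex x)]
    rw [Metric.mem_ball] at hx hy
    linarith

lemma WeakLim.tendsto_measure {μs : ℕ → Measure E} {μ : Measure E}
    [hs : ∀ N, IsProbabilityMeasure (μs N)] [h : IsProbabilityMeasure μ] (hw : WeakLim μs μ)
    {Q : Set E} (hQ : μ (frontier Q) = 0) : Tendsto (fun N => μs N Q) atTop (𝓝 (μ Q)) := by
  let P : ℕ → ProbabilityMeasure E := fun N => ⟨μs N, hs N⟩
  have ht : Tendsto P atTop (𝓝 ⟨μ, h⟩) :=
    ProbabilityMeasure.tendsto_iff_forall_integral_tendsto.2 fun φ => hw φ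
  exact ProbabilityMeasure.tendsto_measure_of_null_frontier_of_tendsto' ht hQ

/-- A measure `μ'` dominates `(1 - ε)` times the image of `μ` under a kernel moving mass by at
most `ε`. -/
def IsNear (ε : ℝ) (μ μ' : Measure E) : Prop :=
  ∃ κ : Kernel E E, IsMarkovKernel κ ∧ ENNReal.ofReal (1 - ε) • μ.bind κ ≤ μ' ∧
    ∀ᵐ x ∂μ, ∀ᵐ y ∂(κ x), dist x y ≤ ε

lemma isNear_one (μ μ' : Measure E) : IsNear 1 μ μ' := by
  refine ⟨Kernel.id, inferInstance, by simpa using Measure.zero_le μ', Eventually.of_forall fun x => ?_⟩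
  rw [Kernel.id_apply, ae_dirac_iff (measurableSet_le (by fun_prop) (by fun_prop))]
  simp

lemma isNear_of_partition {ε : ℝ} {μ μ' : Measure E} [IsProbabilityMeasure μ']
    {q : E → ℕ} {M : ℕ} (hq : Measurable q) (hqM : ∀ᵐ x ∂μ, q x < M)
    (hd : ∀ x y, q x = q y → q x < M → dist x y ≤ ε)
    (hle : ∀ i < M, ENNReal.ofReal (1 - ε) * μ (q ⁻¹' {i}) ≤ μ' (q ⁻¹' {i})) :
    IsNear ε μ μ' := by
  classical
  have hQ : ∀ i, MeasurableSet (q ⁻¹' {i}) := fun i => hq (measurableSet_singleton i)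
  have hν : ∀ i, ∃ ν : Measure E, IsProbabilityMeasure ν ∧
      ((q ⁻¹' {i}).Nonempty → ∀ᵐ y ∂ν, q y = i) ∧
      ∀ B, MeasurableSet B → μ' (q ⁻¹' {i}) * ν B ≤ μ' (q ⁻¹' {i} ∩ B) := by
    intro i
    by_cases h0 : μ' (q ⁻¹' {i}) = 0
    · by_cases hne : (q ⁻¹' {i}).Nonempty
      · obtain ⟨p, hp⟩ := hne
        refine ⟨Measure.dirac p, inferInstance, fun _ => ?_, by simp [h0]⟩
        exact (ae_dirac_iff (hQ i)).2 hp
      · exact ⟨μ', inferInstance, fun h => absurd h hne, by simp [h0]⟩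
    · refine ⟨μ'[|q ⁻¹' {i}], cond_isProbabilityMeasure h0, fun _ => ?_, fun B hB => ?_⟩
      · exact ae_cond_mem (hQ i)
      · rw [cond_apply (hQ i), ← mul_assoc, ENNReal.mul_inv_cancel h0 (measure_ne_top _ _),
          one_mul]
  choose ν hνp hνq hνB using hν
  let κ₀ : Kernel ℕ E := ⟨ν, measurable_from_nat⟩
  have hκ₀ : IsMarkovKernel κ₀ := ⟨hνp⟩
  refine ⟨κ₀.comap q hq, inferInstance, ?_, ?_⟩
  · refine Measure.le_iff.2 fun B hB => ?_
    rw [Measure.smul_apply, Measure.bind_apply hB (Kernel.aemeasurable _), smul_eq_mul]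
    have e1 : ∫⁻ x, (κ₀.comap q hq) x B ∂μ = ∑' i, ν i B * μ (q ⁻¹' {i}) := by
      have : ∫⁻ x, (κ₀.comap q hq) x B ∂μ = ∫⁻ i, ν i B ∂(μ.map q) := by
        rw [lintegral_map measurable_from_nat hq]
        rfl
      rw [this, lintegral_countable']
      simp_rw [Measure.map_apply hq (measurableSet_singleton _)]
    rw [e1, ← ENNReal.tsum_mul_left]
    have e2 : μ' B = ∑' i, μ' (q ⁻¹' {i} ∩ B) := by
      rw [← measure_iUnion]
      · congr 1
        ext x
        simp
      · intro i j hij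
        refine Set.disjoint_left.2 fun x hx hx' => hij ?_
        exact hx.1.symm.trans hx'.1
      · exact fun i => (hQ i).inter hB
    rw [e2]
    refine ENNReal.tsum_le_tsum fun i => ?_
    rcases lt_or_ge i M with hi | hi
    · calc _ = ENNReal.ofReal (1 - ε) * μ (q ⁻¹' {i}) * ν i B := by ring
        _ ≤ μ' (q ⁻¹' {i}) * ν i B := by gcongr; exact hle i hi
        _ ≤ _ := hνB i B hB
    · have : μ (q ⁻¹' {i}) = 0 := by
        refine measure_mono_null (fun x hx => ?_) (ae_iff.1 hqM)
        have : q x = i := hx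
        simp [this, hi]
      simp [this]
  · filter_upwards [hqM] with x hx
    have := hνq (q x) ⟨x, rfl⟩
    change ∀ᵐ y ∂(ν (q x)), dist x y ≤ ε
    filter_upwards [this] with y hy
    exact hd x y hy.symm hx

lemma WeakLim.eventually_isNear {μs : ℕ → Measure E} {μ : Measure E}
    [∀ N, IsProbabilityMeasure (μs N)] [IsProbabilityMeasure μ] (hw : WeakLim μs μ)
    {K : Set E} (hK : IsCompact K) (hμK : ∀ᵐ x ∂μ, x ∈ K) {ε : ℝ} (hε : 0 < ε) :
    ∀ᶠ N in atTop, IsNear ε μ (μs N) := by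
  obtain ⟨q, M, hq, hf, hqM, hd⟩ := exists_small_partition μ hK hμK hε
  have hev : ∀ i, ∀ᶠ N in atTop,
      ENNReal.ofReal (1 - ε) * μ (q ⁻¹' {i}) ≤ μs N (q ⁻¹' {i}) := by
    intro i
    by_cases h0 : μ (q ⁻¹' {i}) = 0
    · simp [h0]
    · refine ((hw.tendsto_measure (hf i)).eventually_const_lt ?_).mono fun N h => h.le
      conv_rhs => rw [← one_mul (μ (q ⁻¹' {i}))]
      refine ENNReal.mul_lt_mul_left h0 (measure_ne_top _ _) ?_
      rw [ENNReal.ofReal_lt_one]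
      linarith
  have : ∀ᶠ N in atTop, ∀ i ∈ Finset.range M,
      ENNReal.ofReal (1 - ε) * μ (q ⁻¹' {i}) ≤ μs N (q ⁻¹' {i}) :=
    (Finset.eventually_all _).2 fun i _ => hev i
  filter_upwards [this] with N hN
  exact isNear_of_partition hq hqM hd fun i hi => hN i (Finset.mem_range.2 hi)

lemma exists_map_of_isNear [SecondCountableTopology E] [StandardBorelSpace E] [Nonempty E]
    {μ μ' : Measure E}
    [IsProbabilityMeasure μ] [IsProbabilityMeasure μ'] {ε : ℝ} (hε : 0 < ε) (hε1 : ε ≤ 1)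
    (h : IsNear ε μ μ') :
    ∃ f : E × unitInterval × unitInterval → E, Measurable f ∧
      (μ.prod (volume.prod volume)).map f = μ' ∧
      ∀ᵐ p ∂(μ.prod (volume.prod volume)), (p.2.1 : ℝ) < 1 - ε → dist p.1 (f p) ≤ ε := by
  obtain ⟨κ, hκ, hle, hd⟩ := h
  set A := ENNReal.ofReal (1 - ε) • μ.bind κ with hA
  have hbind : IsProbabilityMeasure (μ.bind κ) := inferInstance
  have hAfin : IsFiniteMeasure A := isFiniteMeasure_of_le μ' hle
  have hε0 : ENNReal.ofReal ε ≠ 0 := by simpa using hε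
  set R := (ENNReal.ofReal ε)⁻¹ • (μ' - A) with hR
  have hεR : ENNReal.ofReal ε • R = μ' - A := by
    rw [hR, smul_smul, ENNReal.mul_inv_cancel hε0 ENNReal.ofReal_ne_top, one_smul]
  have hsum : A + ENNReal.ofReal ε • R = μ' := by
    rw [hεR, add_comm, Measure.sub_add_cancel_of_le hle]
  have hRp : IsProbabilityMeasure R := by
    refine ⟨?_⟩
    have h1 : (μ' - A) Set.univ = ENNReal.ofReal ε := by
      rw [Measure.sub_apply MeasurableSet.univ hle, hA, Measure.smul_apply, measure_univ,
        measure_univ, smul_eq_mul, mul_one, ← ENNReal.ofReal_one, ← ENNReal.ofReal_sub _ (by linarith)]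
      congr 1
      ring
    rw [hR, Measure.smul_apply, h1, smul_eq_mul, ENNReal.inv_mul_cancel hε0 ENNReal.ofReal_ne_top]
  clear_value R
  obtain ⟨F, hF, hFκ⟩ := κ.exists_measurable_map_eq_unitInterval
  obtain ⟨G, hG, hGR⟩ := R.exists_measurable_map_eq
  have hS : MeasurableSet {u : unitInterval | (u : ℝ) < 1 - ε} :=
    measurableSet_lt measurable_subtype_coe measurable_const
  have hSv : volume {u : unitInterval | (u : ℝ) < 1 - ε} = ENNReal.ofReal (1 - ε) := by
    have : {u : unitInterval | (u : ℝ) < 1 - ε} =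
        Set.Iio ⟨1 - ε, by linarith, by linarith⟩ := rfl
    rw [this, unitInterval.volume_Iio]
  have hSv' : volume {u : unitInterval | (u : ℝ) < 1 - ε}ᶜ = ENNReal.ofReal ε := by
    rw [prob_compl_eq_one_sub hS, hSv, ← ENNReal.ofReal_one, ← ENNReal.ofReal_sub _ (by linarith)]
    congr 1
    ring
  classical
  set f : E × unitInterval × unitInterval → E := fun p =>
    if (p.2.1 : ℝ) < 1 - ε then F p.1 p.2.2 else G p.2.2 with hf
  have hfm : Measurable f := by
    refine Measurable.ite ?_ ?_ ?_
    · exact (measurable_fst.comp measurable_snd) hS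
    · exact hF.comp (measurable_fst.prodMk (measurable_snd.comp measurable_snd))
    · exact hG.comp (measurable_snd.comp measurable_snd)
  refine ⟨f, hfm, ?_, ?_⟩
  · rw [← hsum]
    refine Measure.ext fun B hB => ?_
    have hin : ∀ (x : E) (u : unitInterval),
        volume ((fun v => f (x, u, v)) ⁻¹' B) =
          if (u : ℝ) < 1 - ε then κ x B else R B := by
      intro x u
      split_ifs with hu
      · rw [← hFκ x, Measure.map_apply hF.of_uncurry_left hB]
        simp [hf, hu]
      · rw [← hGR, Measure.map_apply hG hB]
        simp [hf, hu]
    rw [Measure.map_apply hfm hB, Measure.prod_apply (hfm hB)]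
    calc ∫⁻ x, (volume.prod volume) (Prod.mk x ⁻¹' (f ⁻¹' B)) ∂μ
        = ∫⁻ x, (ENNReal.ofReal (1 - ε) * κ x B + ENNReal.ofReal ε * R B) ∂μ := by
          refine lintegral_congr fun x => ?_
          rw [Measure.prod_apply (measurable_prodMk_left (hfm hB))]
          have : ∀ u : unitInterval, volume (Prod.mk u ⁻¹' (Prod.mk x ⁻¹' (f ⁻¹' B))) =
              if (u : ℝ) < 1 - ε then κ x B else R B := hin x
          simp_rw [this]
          have e1 : ∫⁻ u in {u : unitInterval | (u : ℝ) < 1 - ε},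
              (if (u : ℝ) < 1 - ε then κ x B else R B) = ENNReal.ofReal (1 - ε) * κ x B := by
            rw [setLIntegral_congr_fun (g := fun _ => κ x B) hS (fun u hu => if_pos (show (u : ℝ) < 1 - ε from hu)),
              setLIntegral_const, hSv, mul_comm]
          have e2 : ∫⁻ u in {u : unitInterval | (u : ℝ) < 1 - ε}ᶜ,
              (if (u : ℝ) < 1 - ε then κ x B else R B) = ENNReal.ofReal ε * R B := by
            rw [setLIntegral_congr_fun (g := fun _ => R B) hS.compl (fun u hu => if_neg (show ¬(u : ℝ) < 1 - ε from hu)),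
              setLIntegral_const, hSv', mul_comm]
          rw [← lintegral_add_compl _ hS, e1, e2]
      _ = _ := by
          rw [lintegral_add_right _ measurable_const, lintegral_const_mul _ (κ.measurable_coe hB),
            Measure.add_apply, hA, Measure.smul_apply, Measure.smul_apply,
            Measure.bind_apply hB κ.aemeasurable]
          simp
  · have hdm : MeasurableSet
        {p : E × unitInterval × unitInterval | (p.2.1 : ℝ) < 1 - ε → dist p.1 (f p) ≤ ε} := by
      have h1 : MeasurableSet {p : E × unitInterval × unitInterval | (p.2.1 : ℝ) < 1 - ε} :=
        (measurable_fst.comp measurable_snd) hS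
      have h2 : MeasurableSet {p : E × unitInterval × unitInterval | dist p.1 (f p) ≤ ε} :=
        measurableSet_le (measurable_fst.dist hfm) measurable_const
      exact h1.imp h2
    rw [Measure.ae_prod_iff_ae_ae hdm]
    filter_upwards [hd] with x hx
    refine (Measure.ae_prod_iff_ae_ae (p := fun w : unitInterval × unitInterval =>
      (w.1 : ℝ) < 1 - ε → dist x (f (x, w)) ≤ ε) (measurable_prodMk_left hdm)).2 ?_
    refine Eventually.of_forall fun u => ?_
    rw [← hFκ x, ae_map_iff hF.of_uncurry_left.aemeasurable
      (measurableSet_le (by fun_prop) (by fun_prop))] at hx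
    filter_upwards [hx] with v hv hu
    simpa [hf, show (u : ℝ) < 1 - ε from hu] using hv

/-- A weakly convergent sequence of laws near a compactly supported limit is realized by almost
surely convergent random variables. -/
lemma WeakLim.exists_coupling [SecondCountableTopology E] [StandardBorelSpace E] [Nonempty E]
    {μs : ℕ → Measure E}
    {μ : Measure E} [∀ N, IsProbabilityMeasure (μs N)] [IsProbabilityMeasure μ]
    (hw : WeakLim μs μ) {K : Set E} (hK : IsCompact K) (hμK : ∀ᵐ x ∂μ, x ∈ K) :
    ∃ f : ℕ → E × unitInterval × unitInterval → E, (∀ N, Measurable (f N)) ∧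
      (∀ N, (μ.prod (volume.prod volume)).map (f N) = μs N) ∧
      ∀ᵐ p ∂(μ.prod (volume.prod volume)), Tendsto (fun N => f N p) atTop (𝓝 p.1) := by
  classical
  set k : ℕ → ℕ := fun N =>
    Nat.findGreatest (fun k => IsNear (1 / ((k : ℝ) + 1)) μ (μs N)) N with hk
  have hkN : ∀ N, IsNear (1 / ((k N : ℝ) + 1)) μ (μs N) := fun N =>
    Nat.findGreatest_spec (P := fun k => IsNear (1 / ((k : ℝ) + 1)) μ (μs N)) (Nat.zero_le N)
      (by simpa using isNear_one μ (μs N))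
  have hkt : Tendsto k atTop atTop := by
    refine tendsto_atTop.2 fun j => ?_
    filter_upwards [hw.eventually_isNear hK hμK (ε := 1 / ((j : ℝ) + 1)) (by positivity),
      eventually_ge_atTop j] with N h1 h2
    exact Nat.le_findGreatest h2 h1
  have hεt : Tendsto (fun N => 1 / ((k N : ℝ) + 1)) atTop (𝓝 0) :=
    tendsto_one_div_add_atTop_nhds_zero_nat.comp hkt
  have hstep : ∀ N, _ := fun N => exists_map_of_isNear (ε := 1 / ((k N : ℝ) + 1)) (by positivity)
    (by rw [div_le_one (by positivity)]; linarith [(k N).cast_nonneg (α := ℝ)]) (hkN N)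
  choose f hfm hfμ hfd using hstep
  refine ⟨f, hfm, hfμ, ?_⟩
  have hu : ∀ᵐ p : E × unitInterval × unitInterval ∂(μ.prod (volume.prod volume)),
      (p.2.1 : ℝ) < 1 := by
    have h1 : ∀ᵐ u : unitInterval, u ≠ 1 := Measure.ae_ne volume 1
    have h2 := (Measure.quasiMeasurePreserving_fst (μ := (volume : Measure unitInterval))
      (ν := (volume : Measure unitInterval))).ae h1
    have h3 := (Measure.quasiMeasurePreserving_snd (μ := μ)
      (ν := (volume : Measure unitInterval).prod (volume : Measure unitInterval))).ae h2
    filter_upwards [h3] with p hp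
    exact lt_of_le_of_ne p.2.1.2.2 fun h => hp (Subtype.ext h)
  filter_upwards [ae_all_iff.2 hfd, hu] with p hp hp1
  rw [tendsto_iff_dist_tendsto_zero]
  refine squeeze_zero' (Eventually.of_forall fun _ => dist_nonneg) ?_ hεt
  filter_upwards [hεt.eventually_lt_const (sub_pos.2 hp1)] with N hN
  rw [dist_comm]
  exact hp N (by linarith)

end Coupling

section Perturbation

variable {a b : ℝ} {n : ℕ}

/-- The curve `γ` with the affine function interpolating `u` and `v` added. -/
noncomputable def perturb (γ : CPath a b n) (u v : Eu n) : CPath a b n where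
  toFun t := γ t + (u + (((t : ℝ) - a) / (b - a)) • (v - u))
  continuous_toFun := by fun_prop

lemma perturb_apply (γ : CPath a b n) (u v : Eu n) (t : Set.Icc a b) :
    perturb γ u v t = γ t + (u + (((t : ℝ) - a) / (b - a)) • (v - u)) := rfl

lemma pev_perturb (γ : CPath a b n) (u v : Eu n) {t : ℝ} (ht : t ∈ Set.Icc a b) :
    pev (perturb γ u v) t = pev γ t + (u + ((t - a) / (b - a)) • (v - u)) := by
  rw [pev_of_mem _ ht, pev_of_mem _ ht, perturb_apply]

lemma pev_perturb_left (hab : a ≤ b) (γ : CPath a b n) (u v : Eu n) :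
    pev (perturb γ u v) a = pev γ a + u := by
  simp [pev_perturb γ u v (Set.left_mem_Icc.2 hab)]

lemma pev_perturb_right (hab : a < b) (γ : CPath a b n) (u v : Eu n) :
    pev (perturb γ u v) b = pev γ b + v := by
  rw [pev_perturb γ u v (Set.right_mem_Icc.2 hab.le), div_self (sub_pos.2 hab).ne']
  simp

lemma dist_perturb_le (hab : a < b) (γ : CPath a b n) (u v : Eu n) :
    dist (perturb γ u v) γ ≤ ‖u‖ + ‖v‖ := by
  refine (ContinuousMap.dist_le (by positivity)).2 fun t => ?_
  rw [perturb_apply, dist_self_add_left]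
  set θ := ((t : ℝ) - a) / (b - a) with hθ
  have hT := sub_pos.2 hab
  have h0 : 0 ≤ θ := div_nonneg (sub_nonneg.2 t.2.1) hT.le
  have h1 : θ ≤ 1 := by
    rw [hθ, div_le_one hT]
    linarith [t.2.2]
  have e : u + θ • (v - u) = (1 - θ) • u + θ • v := by module
  rw [e]
  refine (norm_add_le _ _).trans ?_
  rw [norm_smul, norm_smul, Real.norm_of_nonneg h0, Real.norm_of_nonneg (sub_nonneg.2 h1)]
  nlinarith [norm_nonneg u, norm_nonneg v]

lemma continuous_perturb :
    Continuous fun p : CPath a b n × Eu n × Eu n => perturb p.1 p.2.1 p.2.2 := by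
  refine ContinuousMap.continuous_of_continuous_uncurry _ ?_
  change Continuous fun p : (CPath a b n × Eu n × Eu n) × Set.Icc a b =>
    p.1.1 p.2 + (p.1.2.1 + (((p.2 : ℝ) - a) / (b - a)) • (p.1.2.2 - p.1.2.1))
  fun_prop

lemma discreteKinetic_perturb_le {τ : ℕ → ℝ} {l : ℕ} {δ : ℝ} (hab : a < b)
    (hp : IsPartition a b τ l δ) (γ : CPath a b n) (u v : Eu n) :
    discreteKinetic τ l (perturb γ u v) ≤ discreteKinetic τ l γ +
      (2 * ‖pev γ b - pev γ a‖ * ‖v - u‖ + ‖v - u‖ ^ 2) / (b - a) := by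
  have hT := sub_pos.2 hab
  have key : discreteKinetic τ l (perturb γ u v) = discreteKinetic τ l γ +
      (2 * inner ℝ (pev γ b - pev γ a) (v - u) / (b - a) + ‖v - u‖ ^ 2 / (b - a)) := by
    have e1 : 2 * inner ℝ (pev γ b - pev γ a) (v - u) / (b - a) = ∑ j ∈ Finset.range l,
        2 * inner ℝ (pev γ (τ (j + 1)) - pev γ (τ j)) (v - u) / (b - a) := by
      rw [← Finset.sum_div, ← Finset.mul_sum, ← sum_inner,
        Finset.sum_range_sub (fun j => pev γ (τ j)), hp.2.1, hp.2.2.1]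
    have e2 : ‖v - u‖ ^ 2 / (b - a) = ∑ j ∈ Finset.range l,
        (τ (j + 1) - τ j) * (‖v - u‖ ^ 2 / (b - a) ^ 2) := by
      rw [← Finset.sum_mul, hp.sum_sub]
      field_simp
    rw [e1, e2, discreteKinetic, discreteKinetic, ← Finset.sum_add_distrib,
      ← Finset.sum_add_distrib]
    refine Finset.sum_congr rfl fun j hj => ?_
    have hj := Finset.mem_range.1 hj
    have hlt := sub_pos.2 (hp.2.2.2.1 j hj)
    rw [pev_perturb γ u v (hp.mem_Icc hj), pev_perturb γ u v (hp.mem_Icc hj.le)]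
    have e3 : pev γ (τ (j + 1)) + (u + ((τ (j + 1) - a) / (b - a)) • (v - u)) -
        (pev γ (τ j) + (u + ((τ j - a) / (b - a)) • (v - u))) =
        (pev γ (τ (j + 1)) - pev γ (τ j)) + ((τ (j + 1) - τ j) / (b - a)) • (v - u) := by
      have : (τ (j + 1) - τ j) / (b - a) = (τ (j + 1) - a) / (b - a) - (τ j - a) / (b - a) := by
        ring
      rw [this]
      module
    rw [e3, norm_add_sq_real, norm_smul, inner_smul_right, mul_pow, Real.norm_eq_abs, sq_abs]
    field_simp
    ring
  have hin := real_inner_le_norm (pev γ b - pev γ a) (v - u)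
  rw [key, ← add_div]
  refine add_le_add_right (div_le_div_of_nonneg_right ?_ hT.le) _
  linarith

/-- The cost of moving the endpoints of `γ` by `u` and `v` and discretizing. -/
noncomputable def perturbCost (m : ℝ) (V : Eu n → ℝ) (τ : ℕ → ℝ) (l : ℕ) (γ : CPath a b n)
    (u v : Eu n) : ℝ :=
  m / 2 * ((2 * ‖pev γ b - pev γ a‖ * ‖v - u‖ + ‖v - u‖ ^ 2) / (b - a)) +
    (potential V γ - discretePotential V τ l (perturb γ u v))

lemma shiftedDAction_interp_perturb_le (hab : a < b) {m : ℝ} (hm : 0 < m) (V : Eu n → ℝ)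
    (C : ℝ≥0) {τ : ℕ → ℝ} {l : ℕ} {δ : ℝ} (hp : IsPartition a b τ l δ) (γ : CPath a b n)
    (u v : Eu n) :
    shiftedDAction m V τ l C (interp τ l (perturb γ u v)) ≤
      shiftedAction m V C γ + ENNReal.ofReal (perturbCost m V τ l γ u v) := by
  by_cases hγ : ∃ g, IsL2Deriv γ g
  · obtain ⟨g, hg⟩ := hγ
    rw [shiftedDAction, if_pos (piecewiseAffine_interp hp _), hg.shiftedAction_eq hab]
    refine le_trans (ENNReal.ofReal_le_ofReal ?_) ENNReal.ofReal_add_le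
    rw [dActionSum_eq, discreteKinetic_interp hp, discretePotential_interp V hp, perturbCost]
    have h1 := discreteKinetic_perturb_le hab hp γ u v
    have h2 := hg.discreteKinetic_le hp
    have h3 := mul_le_mul_of_nonneg_left (h1.trans (add_le_add_left h2 _))
      (show 0 ≤ m / 2 by positivity)
    rw [mul_add] at h3
    linarith
  · rw [shiftedAction_eq_top hab hm V C hγ, top_add]
    exact le_top

lemma tendsto_perturbCost (hab : a < b) (m : ℝ) {V : Eu n → ℝ} (hV : Continuous V)
    {h : ℕ → ℝ} (hto0 : Tendsto h atTop (𝓝 0)) {l : ℕ → ℕ} {τ : ℕ → ℕ → ℝ}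
    (hpart : ∀ N, IsPartition a b (τ N) (l N) (h N)) (γ : CPath a b n) {u v : ℕ → Eu n}
    (hu : Tendsto u atTop (𝓝 0)) (hv : Tendsto v atTop (𝓝 0)) :
    Tendsto (fun N => perturbCost m V (τ N) (l N) γ (u N) (v N)) atTop (𝓝 0) := by
  have hw : Tendsto (fun N => ‖v N - u N‖) atTop (𝓝 0) := by
    simpa using (hv.sub hu).norm
  have h1 : Tendsto (fun N => m / 2 *
      ((2 * ‖pev γ b - pev γ a‖ * ‖v N - u N‖ + ‖v N - u N‖ ^ 2) / (b - a))) atTop (𝓝 0) := by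
    simpa using (((hw.const_mul (2 * ‖pev γ b - pev γ a‖)).add (hw.pow 2)).div_const
      (b - a)).const_mul (m / 2)
  have hd : Tendsto (fun N => dist γ (perturb γ (u N) (v N))) atTop (𝓝 0) := by
    refine squeeze_zero (fun _ => dist_nonneg)
      (fun N => (dist_comm _ _).trans_le (dist_perturb_le hab γ (u N) (v N))) ?_
    simpa using hu.norm.add hv.norm
  have h2 : Tendsto (fun N => potential V γ -
      discretePotential V (τ N) (l N) (perturb γ (u N) (v N))) atTop (𝓝 0) := by
    refine Metric.tendsto_nhds.2 fun ε hε => ?_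
    obtain ⟨δ, hδ, H⟩ := exists_discretePotential_close (n := n) hab hV (‖γ‖ + 1) (half_pos hε)
    obtain ⟨η, hη, Hη⟩ := exists_modulus γ hδ
    filter_upwards [hd.eventually_lt_const (lt_min hδ one_pos),
      hto0.eventually_lt_const hη] with N hN hN'
    have hN1 := hN.le.trans (min_le_right _ _)
    have hnorm : ‖perturb γ (u N) (v N)‖ ≤ ‖γ‖ + 1 := by
      rw [dist_comm, dist_eq_norm] at hN1
      linarith [norm_sub_norm_le (perturb γ (u N) (v N)) γ]
    have := H _ _ _ (hpart N) γ _ (by linarith) hnorm (hN.le.trans (min_le_left _ _))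
      fun s t hst => Hη s t (hst.trans hN'.le)
    rw [Real.dist_eq, sub_zero, abs_sub_comm]
    linarith
  simpa only [perturbCost, add_zero] using h1.add h2

lemma tendsto_interp_perturb (hab : a < b)
    {h : ℕ → ℝ} (hto0 : Tendsto h atTop (𝓝 0)) {l : ℕ → ℕ} {τ : ℕ → ℕ → ℝ}
    (hpart : ∀ N, IsPartition a b (τ N) (l N) (h N)) (γ : CPath a b n) {u v : ℕ → Eu n}
    (hu : Tendsto u atTop (𝓝 0)) (hv : Tendsto v atTop (𝓝 0)) :
    Tendsto (fun N => interp (τ N) (l N) (perturb γ (u N) (v N))) atTop (𝓝 γ) := by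
  have hd : Tendsto (fun N => ‖u N‖ + ‖v N‖) atTop (𝓝 0) := by
    simpa using hu.norm.add hv.norm
  refine Metric.tendsto_nhds.2 fun ε hε => ?_
  obtain ⟨η, hη, Hη⟩ := exists_modulus γ (show 0 < ε / 5 by positivity)
  filter_upwards [hd.eventually_lt_const (show 0 < ε / 5 by positivity),
    hto0.eventually_lt_const hη] with N hN hN'
  have h1 := (dist_perturb_le hab γ (u N) (v N)).trans hN.le
  have h2 := dist_interp_le (hpart N) (perturb γ (u N) (v N)) (η := 3 * (ε / 5)) (by positivity)
    fun s t hst => by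
      have hs := (ContinuousMap.dist_apply_le_dist (f := perturb γ (u N) (v N)) (g := γ) s).trans h1
      have ht := (ContinuousMap.dist_apply_le_dist (f := perturb γ (u N) (v N)) (g := γ) t).trans h1
      rw [dist_comm] at ht
      linarith [dist_triangle4 (perturb γ (u N) (v N) s) (γ s) (γ t) (perturb γ (u N) (v N) t),
        Hη s t (hst.trans hN'.le)]
  linarith [dist_triangle (interp (τ N) (l N) (perturb γ (u N) (v N))) (perturb γ (u N) (v N)) γ]

lemma exists_perturbCost_le (hab : a < b) {m : ℝ} (hm : 0 < m) {V : Eu n → ℝ} {c₂ : ℝ}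
    (hc₂ : 0 < c₂) (hV2 : ∀ x : Eu n, |V x| ≤ c₂ * (1 + ‖x‖ ^ 2)) {R : ℝ} {C : ℝ≥0}
    (hC : PotentialBound a b m V R C) :
    ∃ A B : ℝ≥0, ∀ {τ : ℕ → ℝ} {l : ℕ} {δ : ℝ}, IsPartition a b τ l δ →
      ∀ {γ : CPath a b n} {u v : Eu n}, ‖pev γ a‖ ≤ R → ‖pev γ b‖ ≤ R →
      ‖u‖ ≤ 2 * R → ‖v‖ ≤ 2 * R →
      ENNReal.ofReal (perturbCost m V τ l γ u v) ≤ A + B * shiftedAction m V C γ := by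
  have hT := sub_pos.2 hab
  set A : ℝ := m / 2 * (32 * R ^ 2 / (b - a)) + c₂ * (2 + 38 * R ^ 2) * (b - a) with hA
  set B : ℝ := 6 * c₂ * (b - a) ^ 2 * (4 / m) with hB
  have hA0 : 0 ≤ A := by positivity
  have hB0 : 0 < B := by positivity
  refine ⟨A.toNNReal, B.toNNReal, ?_⟩
  intro τ l δ hp γ u v ha hb hu hv
  by_cases hγ : ∃ g, IsL2Deriv γ g
  swap
  · rw [shiftedAction_eq_top hab hm V C hγ, ENNReal.mul_top (by simpa using hB0), add_top]
    exact le_top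
  obtain ⟨g, hg⟩ := hγ
  set E := ∫ u in Set.Icc a b, ‖g u‖ ^ 2 with hE
  have hE0 : 0 ≤ E := integral_nonneg fun u => by positivity
  have hlow := hC.le_potential hab hg ha
  have hγ2 := hg.norm_pev_sq_le hab ha
  rw [← hE] at hlow hγ2
  set S := 2 * R ^ 2 + 2 * (b - a) * E with hS
  have hd := (dist_perturb_le hab γ u v).trans (add_le_add hu hv)
  have hγ' : ∀ t, ‖pev (perturb γ u v) t‖ ^ 2 ≤ 2 * S + 32 * R ^ 2 := by
    intro t
    have h1 := (dist_pev_le (perturb γ u v) γ t).trans hd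
    rw [dist_eq_norm] at h1
    have h2 : ‖pev (perturb γ u v) t‖ ≤ ‖pev γ t‖ + 4 * R := by
      linarith [norm_sub_norm_le (pev (perturb γ u v) t) (pev γ t)]
    have h3 := pow_le_pow_left₀ (norm_nonneg _) h2 2
    nlinarith [hγ2 t, sq_nonneg (‖pev γ t‖ - 4 * R)]
  have hVB : ∀ Q : ℝ, ∀ x : Eu n, ‖x‖ ^ 2 ≤ Q → |V x| * (b - a) ≤ c₂ * (1 + Q) * (b - a) :=
    fun Q x hx => mul_le_mul_of_nonneg_right ((hV2 x).trans (by gcongr)) hT.le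
  have p1 := abs_le.1 (abs_potential_le V hab hγ2 (hVB _))
  have p2 := abs_le.1 (abs_discretePotential_le V hp hab hγ' (hVB _))
  have hR0 : 0 ≤ R := (norm_nonneg _).trans ha
  have hw : ‖v - u‖ ≤ 4 * R := by linarith [norm_sub_le v u]
  have hba : ‖pev γ b - pev γ a‖ ≤ 2 * R := by linarith [norm_sub_le (pev γ b) (pev γ a)]
  have hk : m / 2 * ((2 * ‖pev γ b - pev γ a‖ * ‖v - u‖ + ‖v - u‖ ^ 2) / (b - a)) ≤
      m / 2 * (32 * R ^ 2 / (b - a)) := by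
    gcongr
    nlinarith [norm_nonneg (v - u), norm_nonneg (pev γ b - pev γ a),
      mul_le_mul hba hw (norm_nonneg _) (by positivity), pow_le_pow_left₀ (norm_nonneg _) hw 2]
  have hfin : perturbCost m V τ l γ u v ≤ A + B * (m / 4 * E) := by
    have e : B * (m / 4 * E) = 6 * c₂ * (b - a) ^ 2 * E := by
      rw [hB]
      field_simp
    rw [perturbCost, e, hA]
    have : c₂ * (1 + S) * (b - a) + c₂ * (1 + (2 * S + 32 * R ^ 2)) * (b - a) =
        c₂ * (2 + 38 * R ^ 2) * (b - a) + 6 * c₂ * (b - a) ^ 2 * E := by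
      rw [hS]
      ring
    linarith [p1.2, p2.1]
  rw [hg.shiftedAction_eq hab, ← hE]
  calc ENNReal.ofReal (perturbCost m V τ l γ u v)
      ≤ ENNReal.ofReal (A + B * (m / 2 * E - potential V γ + C)) :=
        ENNReal.ofReal_le_ofReal (hfin.trans (by gcongr))
    _ ≤ _ := by
        refine ENNReal.ofReal_add_le.trans_eq ?_
        rw [ENNReal.ofReal_mul hB0.le]
        rfl

end Perturbation

section Recovery

variable {a b : ℝ} {n : ℕ}

lemma weakLim_map_of_ae_tendsto {Ω X : Type*} [MeasurableSpace Ω] {P : Measure Ω}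
    [IsProbabilityMeasure P] [TopologicalSpace X] [MeasurableSpace X] [OpensMeasurableSpace X]
    {T : ℕ → Ω → X} {q : Ω → X} (hT : ∀ N, Measurable (T N)) (hq : Measurable q)
    (h : ∀ᵐ ω ∂P, Tendsto (fun N => T N ω) atTop (𝓝 (q ω))) :
    WeakLim (fun N => P.map (T N)) (P.map q) := by
  intro φ
  have key : ∀ f : Ω → X, Measurable f → ∫ x, φ x ∂(P.map f) = ∫ ω, φ (f ω) ∂P := fun f hf =>
    integral_map hf.aemeasurable φ.continuous.measurable.aestronglyMeasurable
  simp_rw [key q hq, fun N => key (T N) (hT N)]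
  refine tendsto_integral_of_dominated_convergence (fun _ => ‖φ‖)
    (fun N => (φ.continuous.measurable.comp (hT N)).aestronglyMeasurable)
    (integrable_const _) (fun N => Eventually.of_forall fun ω => φ.norm_coe_le_norm _) ?_
  filter_upwards [h] with ω hω using (φ.continuous.tendsto _).comp hω

/-- The interpolated curve with endpoints moved to `x` and `y`. -/
noncomputable def steer (τ : ℕ → ℝ) (l : ℕ) (γ : CPath a b n) (x y : Eu n) : CPath a b n :=
  interp τ l (perturb γ (x - pev γ a) (y - pev γ b))

lemma measurable_steer (τ : ℕ → ℝ) (l : ℕ) {Ω : Type*} [MeasurableSpace Ω]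
    {q : Ω → CPath a b n} (hq : Measurable q) {X Y : Ω → Eu n} (hX : Measurable X)
    (hY : Measurable Y) : Measurable fun ω => steer τ l (q ω) (X ω) (Y ω) := by
  have h := fun t => (continuous_pev_left (a := a) (b := b) (n := n) t).measurable.comp hq
  exact (continuous_interp τ l).measurable.comp (continuous_perturb.measurable.comp
    (hq.prodMk ((hX.sub (h a)).prodMk (hY.sub (h b)))))

lemma pev_steer_left {τ : ℕ → ℝ} {l : ℕ} {δ : ℝ} (hab : a ≤ b) (hp : IsPartition a b τ l δ)
    (γ : CPath a b n) (x y : Eu n) : pev (steer τ l γ x y) a = x := by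
  have := pev_interp hp (perturb γ (x - pev γ a) (y - pev γ b)) (Nat.zero_le l)
  rw [hp.2.1, pev_perturb_left hab] at this
  rw [steer, this, add_sub_cancel]

lemma pev_steer_right {τ : ℕ → ℝ} {l : ℕ} {δ : ℝ} (hab : a < b) (hp : IsPartition a b τ l δ)
    (γ : CPath a b n) (x y : Eu n) : pev (steer τ l γ x y) b = y := by
  have := pev_interp hp (perturb γ (x - pev γ a) (y - pev γ b)) le_rfl
  rw [hp.2.2.1, pev_perturb_right hab] at this
  rw [steer, this, add_sub_cancel]

/-- Steering almost every curve to convergent endpoints recovers the action in the limit. -/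
lemma PotentialBound.limsup_lintegral_steer_le (hab : a < b) {m : ℝ} (hm : 0 < m) {V : Eu n → ℝ}
    (hV : Continuous V) {c₂ : ℝ} (hc₂ : 0 < c₂) (hV2 : ∀ x : Eu n, |V x| ≤ c₂ * (1 + ‖x‖ ^ 2))
    {R : ℝ} {C : ℝ≥0} (hC : PotentialBound a b m V R C)
    {h : ℕ → ℝ} (hto0 : Tendsto h atTop (𝓝 0)) {l : ℕ → ℕ} {τ : ℕ → ℕ → ℝ}
    (hpart : ∀ N, IsPartition a b (τ N) (l N) (h N))
    {Ω : Type*} [MeasurableSpace Ω] {P : Measure Ω} [IsProbabilityMeasure P]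
    {q : Ω → CPath a b n} (hq : Measurable q) {X Y : ℕ → Ω → Eu n}
    (hX : ∀ N, Measurable (X N)) (hY : ∀ N, Measurable (Y N))
    (hXt : ∀ᵐ ω ∂P, Tendsto (fun N => X N ω) atTop (𝓝 (pev (q ω) a)))
    (hYt : ∀ᵐ ω ∂P, Tendsto (fun N => Y N ω) atTop (𝓝 (pev (q ω) b)))
    (ha : ∀ᵐ ω ∂P, ‖pev (q ω) a‖ ≤ R) (hb : ∀ᵐ ω ∂P, ‖pev (q ω) b‖ ≤ R)
    (hXR : ∀ N, ∀ᵐ ω ∂P, ‖X N ω‖ ≤ R) (hYR : ∀ N, ∀ᵐ ω ∂P, ‖Y N ω‖ ≤ R)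
    (hI : ∫⁻ ω, shiftedAction m V C (q ω) ∂P ≠ ⊤) :
    limsup (fun N => ∫⁻ ω, shiftedDAction m V (τ N) (l N) C
      (steer (τ N) (l N) (q ω) (X N ω) (Y N ω)) ∂P) atTop ≤
      ∫⁻ ω, shiftedAction m V C (q ω) ∂P := by
  obtain ⟨A, B, hAB⟩ := exists_perturbCost_le hab hm hc₂ hV2 hC
  have hSm : Measurable fun ω => shiftedAction m V C (q ω) :=
    (measurable_shiftedAction hab.le m hV C).comp hq
  set r : ℕ → Ω → ℝ := fun N ω => perturbCost m V (τ N) (l N) (q ω)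
    (X N ω - pev (q ω) a) (Y N ω - pev (q ω) b) with hr
  have hpm : ∀ t, Measurable fun ω => pev (q ω) t := fun t =>
    (continuous_pev_left t).measurable.comp hq
  have hrm : ∀ N, Measurable (r N) := by
    intro N
    have h1 : Measurable fun ω => perturb (q ω) (X N ω - pev (q ω) a) (Y N ω - pev (q ω) b) :=
      continuous_perturb.measurable.comp
        (hq.prodMk (((hX N).sub (hpm a)).prodMk ((hY N).sub (hpm b))))
    have h2 : Measurable fun ω => ‖Y N ω - pev (q ω) b - (X N ω - pev (q ω) a)‖ :=
      (((hY N).sub (hpm b)).sub ((hX N).sub (hpm a))).norm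
    have h3 : Measurable fun ω => ‖pev (q ω) b - pev (q ω) a‖ := ((hpm b).sub (hpm a)).norm
    exact ((((h3.const_mul 2).mul h2).add (h2.pow_const 2)).div_const _ |>.const_mul _).add
      (((continuous_potential hab.le hV).measurable.comp hq).sub
        ((continuous_discretePotential hV _ _).measurable.comp h1))
  have hlim : Tendsto (fun N => ∫⁻ ω, ENNReal.ofReal (r N ω) ∂P) atTop (𝓝 0) := by
    rw [← lintegral_zero (μ := P)]
    refine tendsto_lintegral_of_dominated_convergence
      (fun ω => A + B * shiftedAction m V C (q ω)) (fun N => (hrm N).ennreal_ofReal) ?_ ?_ ?_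
    · intro N
      filter_upwards [ha, hb, hXR N, hYR N] with ω h1 h2 h3 h4
      refine hAB (hpart N) h1 h2 ((norm_sub_le _ _).trans ?_) ((norm_sub_le _ _).trans ?_) <;>
        linarith
    · rw [lintegral_add_left measurable_const, lintegral_const_mul _ hSm]
      simp [ENNReal.mul_eq_top, hI]
    · filter_upwards [hXt, hYt] with ω h1 h2
      have h3 := tendsto_perturbCost hab m hV hto0 hpart (q ω)
        (u := fun N => X N ω - pev (q ω) a) (v := fun N => Y N ω - pev (q ω) b)
        (by simpa using h1.sub_const (pev (q ω) a)) (by simpa using h2.sub_const (pev (q ω) b))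
      simpa using ENNReal.tendsto_ofReal h3
  have hle : ∀ N, ∫⁻ ω, shiftedDAction m V (τ N) (l N) C
      (steer (τ N) (l N) (q ω) (X N ω) (Y N ω)) ∂P ≤
      ∫⁻ ω, shiftedAction m V C (q ω) ∂P + ∫⁻ ω, ENNReal.ofReal (r N ω) ∂P := by
    intro N
    rw [← lintegral_add_left hSm]
    exact lintegral_mono fun ω => shiftedDAction_interp_perturb_le hab hm V C (hpart N) _ _ _
  refine (limsup_le_limsup (Eventually.of_forall hle)).trans_eq ?_
  simpa using (hlim.const_add (∫⁻ ω, shiftedAction m V C (q ω) ∂P)).limsup_eq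

/-- Weakly convergent approximations of both marginals of `π` are realized by endpoints that
converge almost surely. -/
lemma exists_endpoint_coupling {μa μb : Measure (Eu n)} [IsProbabilityMeasure μa]
    [IsProbabilityMeasure μb] {R : ℝ} (hμa : ∀ᵐ z ∂μa, ‖z‖ ≤ R) (hμb : ∀ᵐ z ∂μb, ‖z‖ ≤ R)
    {νa νb : ℕ → Measure (Eu n)}
    [∀ N, IsProbabilityMeasure (νa N)] [∀ N, IsProbabilityMeasure (νb N)]
    (hxw : WeakLim νa μa) (hyw : WeakLim νb μb)
    {π : Measure (CPath a b n)} [IsProbabilityMeasure π]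
    (hmarg : π.map (fun γ => pev γ a) = μa ∧ π.map (fun γ => pev γ b) = μb) :
    ∃ (Ω : Type) (_ : MeasurableSpace Ω) (P : Measure Ω) (q : Ω → CPath a b n)
      (X Y : ℕ → Ω → Eu n), IsProbabilityMeasure P ∧ MeasurePreserving q P π ∧
      (∀ N, MeasurePreserving (X N) P (νa N)) ∧ (∀ N, MeasurePreserving (Y N) P (νb N)) ∧
      (∀ᵐ ω ∂P, Tendsto (fun N => X N ω) atTop (𝓝 (pev (q ω) a))) ∧
      ∀ᵐ ω ∂P, Tendsto (fun N => Y N ω) atTop (𝓝 (pev (q ω) b)) := by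
  have hpm : ∀ t, Measurable fun γ : CPath a b n => pev γ t := fun t =>
    (continuous_pev_left t).measurable
  have hcl : ∀ {μ : Measure (Eu n)}, (∀ᵐ z ∂μ, ‖z‖ ≤ R) →
      ∀ᵐ z ∂μ, z ∈ Metric.closedBall (0 : Eu n) R := fun h => h.mono fun z hz => by simpa using hz
  obtain ⟨fa, hfam, hfaμ, hfat⟩ := hxw.exists_coupling (isCompact_closedBall 0 R) (hcl hμa)
  obtain ⟨fb, hfbm, hfbμ, hfbt⟩ := hyw.exists_coupling (isCompact_closedBall 0 R) (hcl hμb)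
  let ρ : Measure (unitInterval × unitInterval) := volume.prod volume
  have hΦa : MeasurePreserving (Prod.map (fun γ : CPath a b n => pev γ a) Prod.fst)
      (π.prod (ρ.prod ρ)) (μa.prod ρ) :=
    MeasurePreserving.prod ⟨hpm a, hmarg.1⟩ measurePreserving_fst
  have hΦb : MeasurePreserving (Prod.map (fun γ : CPath a b n => pev γ b) Prod.snd)
      (π.prod (ρ.prod ρ)) (μb.prod ρ) :=
    MeasurePreserving.prod ⟨hpm b, hmarg.2⟩ measurePreserving_snd
  exact ⟨_, inferInstance, π.prod (ρ.prod ρ), Prod.fst, fun N => fa N ∘ Prod.map _ Prod.fst,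
    fun N => fb N ∘ Prod.map _ Prod.snd, inferInstance, measurePreserving_fst,
    fun N => MeasurePreserving.comp ⟨hfam N, hfaμ N⟩ hΦa,
    fun N => MeasurePreserving.comp ⟨hfbm N, hfbμ N⟩ hΦb,
    hΦa.quasiMeasurePreserving.ae hfat, hΦb.quasiMeasurePreserving.ae hfbt⟩

/-- The existence of recovery sequences. -/
lemma exists_recovery (hab : a < b) {m : ℝ} (hm : 0 < m) {V : Eu n → ℝ}
    (hV : Continuous V) {c₂ : ℝ} (hc₂ : 0 < c₂) (hV2 : ∀ x : Eu n, |V x| ≤ c₂ * (1 + ‖x‖ ^ 2))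
    {R : ℝ} {C : ℝ≥0} (hC : PotentialBound a b m V R C)
    {L : Eu n → Eu n → ℝ} (hL : ∀ x v : Eu n, L x v = m / 2 * ‖v‖ ^ 2 - V x)
    {h : ℕ → ℝ} (hto0 : Tendsto h atTop (𝓝 0)) {l : ℕ → ℕ} {τ : ℕ → ℕ → ℝ}
    (hpart : ∀ N, IsPartition a b (τ N) (l N) (h N))
    {μa μb : Measure (Eu n)} [IsProbabilityMeasure μa] [IsProbabilityMeasure μb]
    (hμa : ∀ᵐ z ∂μa, ‖z‖ ≤ R) (hμb : ∀ᵐ z ∂μb, ‖z‖ ≤ R) {νa νb : ℕ → Measure (Eu n)}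
    [∀ N, IsProbabilityMeasure (νa N)] [∀ N, IsProbabilityMeasure (νb N)]
    (hνa : ∀ N, ∀ᵐ z ∂(νa N), ‖z‖ ≤ R) (hνb : ∀ N, ∀ᵐ z ∂(νb N), ‖z‖ ≤ R)
    (hxw : WeakLim νa μa) (hyw : WeakLim νb μb)
    (π : Measure (CPath a b n)) [IsProbabilityMeasure π] :
    ∃ πs : ℕ → Measure (CPath a b n), (∀ N, IsProbabilityMeasure (πs N)) ∧ WeakLim πs π ∧
      limsup (fun N => aFun (dAction m V a b (τ N) (l N)) (νa N) (νb N) (πs N)) atTop ≤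
        aFun (action L a b) μa μb π := by
  have hpm : ∀ t, Measurable fun γ : CPath a b n => pev γ t := fun t =>
    (continuous_pev_left t).measurable
  have hball : MeasurableSet {z : Eu n | ‖z‖ ≤ R} := measurableSet_le (by fun_prop) (by fun_prop)
  by_cases htop : aFun (action L a b) μa μb π = ⊤
  · exact ⟨fun _ => π, fun _ => inferInstance, fun φ => tendsto_const_nhds, htop.symm ▸ le_top⟩
  have hmarg : π.map (fun γ => pev γ a) = μa ∧ π.map (fun γ => pev γ b) = μb := by
    by_contra hcon
    exact htop (by rw [aFun, if_neg hcon])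
  have hRa : ∀ᵐ γ ∂π, ‖pev γ a‖ ≤ R := by
    rw [← hmarg.1] at hμa
    exact (ae_map_iff (hpm a).aemeasurable hball).1 hμa
  have hRb : ∀ᵐ γ ∂π, ‖pev γ b‖ ≤ R := by
    rw [← hmarg.2] at hμb
    exact (ae_map_iff (hpm b).aemeasurable hball).1 hμb
  have haF : aFun (action L a b) μa μb π =
      ((∫⁻ γ, shiftedAction m V C γ ∂π : ℝ≥0∞) : EReal) - ((C : ℝ) : EReal) := by
    rw [aFun, if_pos hmarg, mint_eq_lintegral_sub
      (measurable_shiftedAction hab.le m hV C).aemeasurable C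
      (hRa.mono fun γ hγ => hC.action_eq hm hV hL hab hγ)]
  have hI : ∫⁻ γ, shiftedAction m V C γ ∂π ≠ ⊤ := fun hI => htop (by rw [haF, hI]; simp)
  obtain ⟨Ω, _, P, q, X, Y, _, hq, hX, hY, hXt, hYt⟩ :=
    exists_endpoint_coupling hμa hμb hxw hyw hmarg
  set T : ℕ → Ω → CPath a b n := fun N ω =>
    steer (τ N) (l N) (q ω) (X N ω) (Y N ω) with hTdef
  have hT : ∀ N, Measurable (T N) := fun N =>
    measurable_steer (τ N) (l N) hq.measurable (hX N).measurable (hY N).measurable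
  have hmargN : ∀ N, (P.map (T N)).map (fun γ => pev γ a) = νa N ∧
      (P.map (T N)).map (fun γ => pev γ b) = νb N := by
    intro N
    have ea : (fun γ => pev γ a) ∘ T N = X N :=
      funext fun ω => pev_steer_left hab.le (hpart N) _ _ _
    have eb : (fun γ => pev γ b) ∘ T N = Y N :=
      funext fun ω => pev_steer_right hab (hpart N) _ _ _
    rw [Measure.map_map (hpm a) (hT N), Measure.map_map (hpm b) (hT N), ea, eb]
    exact ⟨(hX N).map_eq, (hY N).map_eq⟩
  have hprob : ∀ N, IsProbabilityMeasure (P.map (T N)) := fun N =>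
    Measure.isProbabilityMeasure_map (hT N).aemeasurable
  refine ⟨fun N => P.map (T N), hprob, ?_, ?_⟩
  · rw [← hq.map_eq]
    refine weakLim_map_of_ae_tendsto hT hq.measurable ?_
    filter_upwards [hXt, hYt] with ω h1 h2
    exact tendsto_interp_perturb hab hto0 hpart (q ω)
      (by simpa using h1.sub_const (pev (q ω) a)) (by simpa using h2.sub_const (pev (q ω) b))
  have haN : ∀ N, aFun (dAction m V a b (τ N) (l N)) (νa N) (νb N) (P.map (T N)) =
      ((∫⁻ ω, shiftedDAction m V (τ N) (l N) C (T N ω) ∂P : ℝ≥0∞) : EReal) -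
        ((C : ℝ) : EReal) := by
    intro N
    have hR : ∀ᵐ γ ∂(P.map (T N)), ‖pev γ a‖ ≤ R := by
      have := hνa N
      rw [← (hmargN N).1] at this
      exact (ae_map_iff (hpm a).aemeasurable hball).1 this
    rw [aFun, if_pos (hmargN N), mint_eq_lintegral_sub
      (measurable_shiftedDAction m hV _ _ C).aemeasurable C
      (hR.mono fun γ hγ => hC.dAction_eq hm hab (hpart N) hγ),
      lintegral_map (measurable_shiftedDAction m hV _ _ C) (hT N)]
  have hIP : ∫⁻ ω, shiftedAction m V C (q ω) ∂P = ∫⁻ γ, shiftedAction m V C γ ∂π :=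
    hq.lintegral_comp (measurable_shiftedAction hab.le m hV C)
  have hls := hC.limsup_lintegral_steer_le hab hm hV hc₂ hV2 hto0 hpart hq.measurable
    (fun N => (hX N).measurable) (fun N => (hY N).measurable) hXt hYt
    (hq.quasiMeasurePreserving.ae hRa) (hq.quasiMeasurePreserving.ae hRb)
    (fun N => (hX N).quasiMeasurePreserving.ae (hνa N))
    (fun N => (hY N).quasiMeasurePreserving.ae (hνb N)) (hIP ▸ hI)
  rw [hIP] at hls
  refine le_of_forall_gt fun c hc => ?_
  obtain ⟨c', hc1, hc2⟩ := EReal.lt_iff_exists_real_btwn.1 hc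
  rw [haF, EReal.coe_ennreal_sub_lt_iff] at hc1
  refine lt_of_le_of_lt (limsup_le_of_le (by isBoundedDefault) ?_) hc2
  filter_upwards [eventually_lt_of_limsup_lt (hls.trans_lt hc1)] with N hN
  rw [haN]
  exact (EReal.coe_ennreal_sub_lt_iff.2 hN).le

end Recovery

section Empirical

lemma isProbabilityMeasure_emp {X : Type*} [MeasurableSpace X] {N : ℕ} (hN : N ≠ 0)
    (x : Fin N → X) : IsProbabilityMeasure (emp N x) := by
  refine ⟨?_⟩
  simp only [emp, Measure.smul_apply, Measure.coe_finsetSum, Finset.sum_apply, smul_eq_mul,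
    measure_univ, Finset.sum_const, Finset.card_univ, Fintype.card_fin, nsmul_eq_mul, mul_one]
  exact ENNReal.inv_mul_cancel (by exact_mod_cast hN) (ENNReal.natCast_ne_top N)

/-- A sequence of empirical measures can be modified at `N = 0` to consist of probability
measures. -/
lemma exists_isProbabilityMeasure_eq_emp {X : Type*} [TopologicalSpace X] [MeasurableSpace X]
    {x : (N : ℕ) → Fin N → X} {μ : Measure X} [IsProbabilityMeasure μ]
    (hw : WeakLim (fun N => emp N (x N)) μ) {p : X → Prop} (hμ : ∀ᵐ z ∂μ, p z)
    (hx : ∀ N, ∀ᵐ z ∂(emp N (x N)), p z) :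
    ∃ ν : ℕ → Measure X, (∀ N, IsProbabilityMeasure (ν N)) ∧ (∀ N, ∀ᵐ z ∂(ν N), p z) ∧
      WeakLim ν μ ∧ ∀ N ≠ 0, ν N = emp N (x N) := by
  refine ⟨fun N => if N = 0 then μ else emp N (x N), fun N => ?_, fun N => ?_, fun φ => ?_,
    fun N hN => if_neg hN⟩
  · beta_reduce
    split_ifs with hN
    · infer_instance
    · exact isProbabilityMeasure_emp hN _
  · beta_reduce
    split_ifs with hN
    · exact hμ
    · exact hx N
  · refine (hw φ).congr' ?_
    filter_upwards [eventually_ne_atTop 0] with N hN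
    rw [if_neg hN]

end Empirical

/-- **Γ-convergence of the time-discretized optimal transportation meshfree scheme
(Theorem 5.1).** For `L(x,v) = (m/2)|v|² − V(x)` with `|V(x)| ≤ c₂(1+|x|²)`, if `V` is
bounded or `b − a ≤ √(m/(32c₂))`, and the mesh sizes `h_N` tend to `0`, then the
time-discretized functionals `𝔸^{[h_N]}_{μ_a^{(N)},μ_b^{(N)}}` (midpoint rule) Γ-converge
to the continuum functional `𝔸_{μ_a,μ_b}` with respect to weak convergence. -/
theorem gamma_convergence_time_discretized
    {n : ℕ} (hn : 1 ≤ n) {a b : ℝ} (hab : a < b)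
    (m : ℝ) (hm : 0 < m) (V : Eu n → ℝ) (hV1 : ContDiff ℝ (⊤ : ℕ∞) V)
    (c₂ : ℝ) (hc₂ : 0 < c₂) (hV2 : ∀ x : Eu n, |V x| ≤ c₂ * (1 + ‖x‖ ^ 2))
    (L : Eu n → Eu n → ℝ) (hL : ∀ x v : Eu n, L x v = m / 2 * ‖v‖ ^ 2 - V x)
    (hVt : (∃ CV : ℝ, ∀ x, |V x| ≤ CV) ∨ b - a ≤ Real.sqrt (m / (32 * c₂)))
    (h : ℕ → ℝ) (hpos : ∀ N, 0 < h N) (hto0 : Tendsto h atTop (𝓝 0))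
    (l : ℕ → ℕ) (τ : ℕ → ℕ → ℝ) (hpart : ∀ N, IsPartition a b (τ N) (l N) (h N))
    (μa μb : Measure (Eu n)) [IsProbabilityMeasure μa] [IsProbabilityMeasure μb]
    (hμaC : ∃ K : Set (Eu n), IsCompact K ∧ μa K = 1)
    (hμbC : ∃ K : Set (Eu n), IsCompact K ∧ μb K = 1)
    (hμaAC : μa ≪ volume) (hμbAC : μb ≪ volume)
    (x y : (N : ℕ) → Fin N → Eu n)
    (hxinj : ∀ N, Function.Injective (x N))
    (hsupp : ∃ K : Set (Eu n), IsCompact K ∧ ∀ N i, x N i ∈ K ∧ y N i ∈ K)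
    (hxw : WeakLim (fun N => emp N (x N)) μa)
    (hyw : WeakLim (fun N => emp N (y N)) μb) :
    (∀ (πs : ℕ → Measure (CPath a b n)) (π : Measure (CPath a b n)),
      (∀ N, IsProbabilityMeasure (πs N)) → IsProbabilityMeasure π → WeakLim πs π →
      aFun (action L a b) μa μb π ≤
        liminf (fun N =>
          aFun (dAction m V a b (τ N) (l N)) (emp N (x N)) (emp N (y N)) (πs N)) atTop) ∧
    (∀ π : Measure (CPath a b n), IsProbabilityMeasure π →
      ∃ πs : ℕ → Measure (CPath a b n),
        (∀ N, IsProbabilityMeasure (πs N)) ∧ WeakLim πs π ∧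
        Tendsto (fun N =>
            aFun (dAction m V a b (τ N) (l N)) (emp N (x N)) (emp N (y N)) (πs N))
          atTop (𝓝 (aFun (action L a b) μa μb π))) := by
  obtain ⟨Ka, hKa, hKa1⟩ := hμaC
  obtain ⟨Kb, hKb, hKb1⟩ := hμbC
  obtain ⟨K, hK, hxyK⟩ := hsupp
  obtain ⟨R, hR⟩ := ((hKa.union hKb).union hK).isBounded.exists_norm_le
  obtain ⟨C, hC0, hC⟩ := exists_potential_bound hab hm hc₂ hV2 hVt R
  lift C to ℝ≥0 using hC0
  have hμa : ∀ᵐ z ∂μa, ‖z‖ ≤ R := by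
    have : ∀ᵐ z ∂μa, z ∈ Ka := (prob_compl_eq_zero_iff hKa.measurableSet).2 hKa1
    exact this.mono fun z hz => hR z (.inl (.inl hz))
  have hμb : ∀ᵐ z ∂μb, ‖z‖ ≤ R := by
    have : ∀ᵐ z ∂μb, z ∈ Kb := (prob_compl_eq_zero_iff hKb.measurableSet).2 hKb1
    exact this.mono fun z hz => hR z (.inl (.inr hz))
  have hemp : ∀ (N : ℕ) (z : Fin N → Eu n), (∀ i, z i ∈ K) → ∀ᵐ w ∂(emp N z), ‖w‖ ≤ R := by
    intro N z hz
    have : ∀ᵐ w ∂(emp N z), w ∈ K := emp_compl_eq_zero hK.measurableSet hz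
    exact this.mono fun w hw => hR w (.inr hw)
  have hνa : ∀ N, ∀ᵐ z ∂(emp N (x N)), ‖z‖ ≤ R := fun N => hemp N _ fun i => (hxyK N i).1
  have hνb : ∀ N, ∀ᵐ z ∂(emp N (y N)), ‖z‖ ≤ R := fun N => hemp N _ fun i => (hxyK N i).2
  have hV := hV1.continuous
  have hlow : ∀ (πs : ℕ → Measure (CPath a b n)) (π : Measure (CPath a b n)),
      (∀ N, IsProbabilityMeasure (πs N)) → IsProbabilityMeasure π → WeakLim πs π →
      aFun (action L a b) μa μb π ≤ liminf (fun N =>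
        aFun (dAction m V a b (τ N) (l N)) (emp N (x N)) (emp N (y N)) (πs N)) atTop :=
    fun πs π _ _ hπ => aFun_le_liminf hab hm hV hC hL hto0 hpart hμa hνa hxw hyw hπ
  refine ⟨hlow, fun π _ => ?_⟩
  obtain ⟨νa, _, hνaR, hνaw, hνaN⟩ := exists_isProbabilityMeasure_eq_emp hxw hμa hνa
  obtain ⟨νb, _, hνbR, hνbw, hνbN⟩ := exists_isProbabilityMeasure_eq_emp hyw hμb hνb
  obtain ⟨πs, hπs, hπ, hsup⟩ := exists_recovery hab hm hV hc₂ hV2 hC hL hto0 hpart hμa hμb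
    hνaR hνbR hνaw hνbw π
  refine ⟨πs, hπs, hπ, tendsto_of_le_liminf_of_limsup_le (hlow πs π hπs inferInstance hπ) ?_⟩
  refine (limsup_congr ?_).trans_le hsup
  filter_upwards [eventually_ne_atTop 0] with N hN
  rw [hνaN N hN, hνbN N hN]
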